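/- Let k ≥ 3 and let H be a finite k-uniform hypergraph that contains no bicycle. Then Breaker has a winning strategy in the Maker-Breaker game on H. -/

import Mathlib

variable {V : Type*} [DecidableEq V]

/-- Maker has a winning strategy in the Maker-Breaker game, given whose turn it is
(`true` = Maker to move), the remaining unclaimed board `R`, and Maker's current set `M`.
Maker wins if at the end of the game (all elements claimed) her set satisfies `win`. -/
def makerWinsAux (win : Finset V → Prop) : Bool → Finset V → Finset V → Prop
  | true, R, M =>
      if R.Nonempty then ∃ x, ∃ _h : x ∈ R, makerWinsAux win false (R.erase x) (insert x M)
      else win M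
  | false, R, M =>
      if R.Nonempty then ∀ x, x ∈ R → makerWinsAux win true (R.erase x) M
      else win M
termination_by _ R _ => R.card
decreasing_by
  · exact Finset.card_erase_lt_of_mem ‹x ∈ R›
  · exact Finset.card_erase_lt_of_mem ‹x ∈ R›

/-- Breaker has a winning strategy (Maker moves first). -/
def breakerWinsAux (win : Finset V → Prop) : Bool → Finset V → Finset V → Prop
  | true, R, M =>
      if R.Nonempty then ∀ x, x ∈ R → breakerWinsAux win false (R.erase x) (insert x M)
      else ¬ win M
  | false, R, M =>
      if R.Nonempty then ∃ x, ∃ _h : x ∈ R, breakerWinsAux win true (R.erase x) M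
      else ¬ win M
termination_by _ R _ => R.card
decreasing_by
  · exact Finset.card_erase_lt_of_mem ‹x ∈ R›
  · exact Finset.card_erase_lt_of_mem ‹x ∈ R›

/-- Maker wins the Maker-Breaker game on board `X` with winning condition `win`. -/
def MakerWins (win : Finset V → Prop) (X : Finset V) : Prop := makerWinsAux win true X ∅

/-- Breaker wins the Maker-Breaker game on board `X` with winning condition `win`. -/
def BreakerWins (win : Finset V → Prop) (X : Finset V) : Prop := breakerWinsAux win true X ∅


variable {V : Type*} [DecidableEq V]

/-! ### Hypergraphs, edge orders, and configurations.
A (finite) hypergraph is represented by its finite set of edges, each edge being a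
finite set of vertices; an edge order is a duplicate-free list of edges. -/

/-- The vertex set of a list of edges. -/
def vset (l : List (Finset V)) : Finset V := l.foldr (· ∪ ·) ∅

/-- The set of old vertices of the `i`-th edge of an edge order: those vertices of the
`i`-th edge appearing in some earlier edge. -/
def oldOf (l : List (Finset V)) (i : ℕ) : Finset V := l.getD i ∅ ∩ vset (l.take i)

/-- The `i`-th edge is good: it has exactly one old vertex. -/
def GoodAt (l : List (Finset V)) (i : ℕ) : Prop := (oldOf l i).card = 1

/-- The `i`-th edge is bad: it has between `2` and `k-1` old vertices. -/
def BadAt (k : ℕ) (l : List (Finset V)) (i : ℕ) : Prop :=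
  2 ≤ (oldOf l i).card ∧ (oldOf l i).card ≤ k - 1

/-- The `i`-th edge is `k`-bad: all of its `k` vertices are old. -/
def KBadAt (k : ℕ) (l : List (Finset V)) (i : ℕ) : Prop := (oldOf l i).card = k

/-- An allowed edge order: every non-initial edge is good, bad or `k`-bad, i.e. has at
least one old vertex. -/
def Allowed (l : List (Finset V)) : Prop :=
  l.Nodup ∧ ∀ i, 0 < i → i < l.length → 1 ≤ (oldOf l i).card

/-- A valid edge order: every non-initial edge is good or bad. -/
def Valid (k : ℕ) (l : List (Finset V)) : Prop :=
  l.Nodup ∧ ∀ i, 0 < i → i < l.length → 1 ≤ (oldOf l i).card ∧ (oldOf l i).card ≤ k - 1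

/-- Consecutive edges of the order intersect. -/
def Chain (l : List (Finset V)) : Prop :=
  ∀ i, i + 1 < l.length → (l.getD i ∅ ∩ l.getD (i + 1) ∅).Nonempty

/-- An overlapping pair: two (distinct) edges sharing between `2` and `k-1` vertices. -/
def OverlapPair (k : ℕ) (l : List (Finset V)) : Prop :=
  ∃ e f : Finset V, l = [e, f] ∧ e ≠ f ∧ 2 ≤ (e ∩ f).card ∧ (e ∩ f).card ≤ k - 1

/-- A loose cycle: at least three edges; cyclically consecutive edges meet in exactly one
vertex and all other pairs of edges are disjoint. -/
def LooseCycle (l : List (Finset V)) : Prop :=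
  3 ≤ l.length ∧ l.Nodup ∧
  ∀ i j, i < j → j < l.length →
    (l.getD i ∅ ∩ l.getD j ∅).card =
      if j = i + 1 ∨ (i = 0 ∧ j = l.length - 1) then 1 else 0

/-- A loose path: consecutive edges meet in exactly one vertex and all other pairs of
edges are disjoint. -/
def LoosePath (l : List (Finset V)) : Prop :=
  l ≠ [] ∧ l.Nodup ∧
  ∀ i j, i < j → j < l.length →
    (l.getD i ∅ ∩ l.getD j ∅).card = if j = i + 1 then 1 else 0

/-- An overlapping pair or a loose cycle. -/
def OPorLC (k : ℕ) (l : List (Finset V)) : Prop := OverlapPair k l ∨ LooseCycle l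

/-- A spoiled cycle. -/
def SpoiledCycle (k : ℕ) (l : List (Finset V)) : Prop :=
  Valid k l ∧ Chain l ∧
  ∃ (e₁ e₂ : Finset V) (P₂ : List (Finset V)),
    l = e₁ :: e₂ :: P₂ ∧ OverlapPair k [e₁, e₂] ∧ LoosePath P₂ ∧
    ∃ x y : V, x ≠ y ∧
      vset [e₁, e₂] ∩ vset P₂ = {x, y} ∧
      (e₂ \ e₁) ∩ (P₂.getD 0 ∅ \ (if 2 ≤ P₂.length then P₂.getD 1 ∅ else e₁)) = {x} ∧
      (e₁ \ e₂) ∩ (P₂.getD (P₂.length - 1) ∅ \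
        (if 2 ≤ P₂.length then P₂.getD (P₂.length - 2) ∅ else e₂)) = {y}

/-- A double loose cycle. -/
def DoubleLooseCycle (k : ℕ) (l : List (Finset V)) : Prop :=
  Valid k l ∧ Chain l ∧
  ∃ P₁ P₂ : List (Finset V),
    l = P₁ ++ P₂ ∧ LooseCycle P₁ ∧ LoosePath P₂ ∧ 2 ≤ P₂.length ∧
    ∃ x y : V, x ≠ y ∧
      vset P₁ ∩ vset P₂ = {x, y} ∧
      (P₂.getD 0 ∅ \ P₂.getD 1 ∅) ∩ P₁.getD (P₁.length - 1) ∅ = {x} ∧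
      ∃ a < P₁.length, (P₂.getD (P₂.length - 1) ∅ \ P₂.getD (P₂.length - 2) ∅) ∩
        P₁.getD a ∅ = {y}

/-- A double overlapping pair. -/
def DoubleOverlapPair (k : ℕ) (l : List (Finset V)) : Prop :=
  Valid k l ∧ Chain l ∧
  ∃ e₁ e₂ e₃ e₄ : Finset V,
    l = [e₁, e₂, e₃, e₄] ∧ OverlapPair k [e₁, e₂] ∧ OverlapPair k [e₃, e₄] ∧
    (e₃ ∩ e₄).card ≤ k - 2 ∧
    ∃ x y : V, x ≠ y ∧
      vset [e₁, e₂] ∩ vset [e₃, e₄] = {x, y} ∧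
      (e₁ \ e₂) ∩ (e₄ \ e₃) = {x} ∧ (e₂ \ e₁) ∩ (e₃ \ e₄) = {y}

/-- An overlapping pair/loose cycle with handle. -/
def WithHandle (k : ℕ) (l : List (Finset V)) : Prop :=
  Valid k l ∧ Chain l ∧
  ∃ (l' : List (Finset V)) (e : Finset V),
    l = l' ++ [e] ∧ OPorLC k l' ∧ BadAt k l (l.length - 1)

/-- An overlapping pair/loose cycle to overlapping pair/loose cycle. -/
def CycleToCycle (k : ℕ) (l : List (Finset V)) : Prop :=
  Valid k l ∧ Chain l ∧
  ∃ P₁ P₂ P₃ : List (Finset V),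
    l = P₁ ++ P₂ ++ P₃ ∧ OPorLC k P₁ ∧ OPorLC k P₃ ∧
    ((P₂ = [] ∧ (vset P₁ ∩ vset P₃).card = 1) ∨
     (P₂ ≠ [] ∧ LoosePath P₂ ∧
       (vset P₁ ∩ vset P₂).card = 1 ∧ vset P₁ ∩ vset P₃ = ∅ ∧
       (vset P₂ ∩ vset P₃).card = 1 ∧
       (2 ≤ P₂.length →
         P₂.getD 1 ∅ ∩ vset P₁ = ∅ ∧ P₂.getD (P₂.length - 2) ∅ ∩ vset P₃ = ∅)))

/-- A bicycle. -/
def Bicycle (k : ℕ) (l : List (Finset V)) : Prop :=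
  SpoiledCycle k l ∨ DoubleOverlapPair k l ∨ DoubleLooseCycle k l ∨
    WithHandle k l ∨ CycleToCycle k l

/-- The hypergraph with edge set `E` contains a bicycle: some of its edges, under some
edge order, form one. -/
def ContainsBicycle (k : ℕ) (E : Finset (Finset V)) : Prop :=
  ∃ l : List (Finset V), l.toFinset ⊆ E ∧ Bicycle k l

/-- A Pasch configuration (for `k = 3`): four edges spanning six vertices, each vertex
lying in exactly two of the edges, one vertex for each of the six pairs of edges. -/
def Pasch (l : List (Finset V)) : Prop :=
  Allowed l ∧ l.length = 4 ∧ (vset l).card = 6 ∧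
  (∀ v ∈ vset l, ((Finset.range 4).filter fun i => v ∈ l.getD i ∅).card = 2) ∧
  ∀ i j, i < j → j < 4 → (l.getD i ∅ ∩ l.getD j ∅).card = 1

/-- A loose star with centre `c`: edges pairwise disjoint except for the common central
vertex `c`. -/
def LooseStar (l : List (Finset V)) (c : V) : Prop :=
  l ≠ [] ∧ l.Nodup ∧ (∀ e ∈ l, c ∈ e) ∧
  ∀ i j, i < j → j < l.length → l.getD i ∅ ∩ l.getD j ∅ = {c}

/-- A `(k,u,2)`-star: `2u` edges forming two loose `u`-stars whose edges are matched up so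
that matched edges share all their vertices except the two centres. -/
def StarKU2 (k u : ℕ) (l : List (Finset V)) : Prop :=
  Allowed l ∧ l.length = 2 * u ∧
  ∃ (c₁ c₂ : V) (l₁ l₂ : List (Finset V)),
    c₁ ≠ c₂ ∧ l₁.length = u ∧ l₂.length = u ∧
    (l₁ ++ l₂).Perm l ∧ LooseStar l₁ c₁ ∧ LooseStar l₂ c₂ ∧
    ∀ i < u, (l₁.getD i ∅).erase c₁ = (l₂.getD i ∅).erase c₂

/-- A `(k,u,a)`-link: `u` edges spanning `k+a` vertices, any two of which together contain
all `k+a` vertices. -/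
def KLink (k u a : ℕ) (l : List (Finset V)) : Prop :=
  Allowed l ∧ l.length = u ∧ (vset l).card = k + a ∧
  ∀ i j, i < j → j < u → (l.getD i ∅ ∪ l.getD j ∅).card = k + a

/-- The hypergraph with edge set `E` is connected. -/
def HyperConnected (E : Finset (Finset V)) : Prop :=
  ∀ F ⊆ E, F.Nonempty → (E \ F).Nonempty → ∃ e ∈ F, ∃ f ∈ E \ F, (e ∩ f).Nonempty

/-- The hypergraph with edge set `E` is `k`-uniform. -/
def Uniform (k : ℕ) (E : Finset (Finset V)) : Prop := ∀ e ∈ E, e.card = k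

/-! ### Game-theoretic lemmas -/

theorem bw_true_empty {win : Finset V → Prop} {M : Finset V} :
    breakerWinsAux win true ∅ M ↔ ¬ win M := by
  rw [breakerWinsAux]; simp

theorem bw_false_empty {win : Finset V → Prop} {M : Finset V} :
    breakerWinsAux win false ∅ M ↔ ¬ win M := by
  rw [breakerWinsAux]; simp

theorem bw_true_ne {win : Finset V → Prop} {R M : Finset V} (h : R.Nonempty) :
    breakerWinsAux win true R M ↔ ∀ x ∈ R, breakerWinsAux win false (R.erase x) (insert x M) := by
  rw [breakerWinsAux]; simp [h]

theorem bw_false_ne {win : Finset V → Prop} {R M : Finset V} (h : R.Nonempty) :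
    breakerWinsAux win false R M ↔ ∃ x ∈ R, breakerWinsAux win true (R.erase x) M := by
  rw [breakerWinsAux]; simp [h]

/-- If no reachable final set wins, Breaker wins. -/
theorem bw_of_never {win : Finset V → Prop} (n : ℕ) : ∀ (R M : Finset V) (b : Bool), R.card = n →
    (∀ S, S ⊆ R → ¬ win (M ∪ S)) → breakerWinsAux win b R M := by
  induction n with
  | zero =>
    intro R M b hc h
    rw [Finset.card_eq_zero] at hc
    subst hc
    have := h ∅ (by simp)
    rw [Finset.union_empty] at this
    cases b
    · exact bw_false_empty.2 this
    · exact bw_true_empty.2 this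
  | succ n ih =>
    intro R M b hc h
    have hne : R.Nonempty := by rw [← Finset.card_pos]; omega
    cases b
    · rw [bw_false_ne hne]
      obtain ⟨x, hx⟩ := hne
      refine ⟨x, hx, ih _ _ _ (by rw [Finset.card_erase_of_mem hx]; omega) ?_⟩
      intro S hS
      exact h S (hS.trans (Finset.erase_subset _ _))
    · rw [bw_true_ne hne]
      intro x hx
      refine ih _ _ _ (by rw [Finset.card_erase_of_mem hx]; omega) ?_
      intro S hS
      have := h (insert x S) (Finset.insert_subset hx (hS.trans (Finset.erase_subset _ _)))
      convert this using 2
      ext; simp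

/-- An additional Breaker move does not hurt Breaker. -/
theorem bw_erase {win : Finset V → Prop} (hmono : ∀ A B, A ⊆ B → win A → win B) (n : ℕ) :
    ∀ (R M : Finset V) (x : V), R.card = n → x ∈ R → breakerWinsAux win true R M →
      breakerWinsAux win true (R.erase x) M := by
  induction n using Nat.strong_induction_on with
  | _ n ih =>
    intro R M x hc hx h
    have hne : R.Nonempty := ⟨x, hx⟩
    rw [bw_true_ne hne] at h
    by_cases hne2 : (R.erase x).Nonempty
    · rw [bw_true_ne hne2]
      intro y hy
      have hyR := Finset.mem_of_mem_erase hy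
      have hyx := Finset.ne_of_mem_erase hy
      have h1 := h y hyR
      have hxy : x ∈ R.erase y := Finset.mem_erase.2 ⟨hyx.symm, hx⟩
      rw [bw_false_ne ⟨x, hxy⟩] at h1
      obtain ⟨z, hz, h1⟩ := h1
      have hcy : (R.erase y).card < n := by rw [← hc]; exact Finset.card_erase_lt_of_mem hyR
      have hcz : ((R.erase y).erase z).card < n :=
        lt_trans (Finset.card_erase_lt_of_mem hz) hcy
      by_cases hzx : z = x
      · subst hzx
        rw [Finset.erase_right_comm]
        by_cases hne3 : ((R.erase y).erase z).Nonempty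
        · rw [bw_false_ne hne3]
          obtain ⟨t, ht⟩ := hne3
          exact ⟨t, ht, ih _ hcz _ _ _ rfl ht h1⟩
        · rw [Finset.not_nonempty_iff_eq_empty] at hne3
          rw [hne3] at h1 ⊢
          rw [bw_true_empty] at h1
          rwa [bw_false_empty]
      · have hz2 : z ∈ (R.erase x).erase y := by
          simp at hz ⊢; tauto
        rw [bw_false_ne ⟨z, hz2⟩]
        refine ⟨z, hz2, ?_⟩
        have := ih _ hcz _ _ x rfl (by simp at hz ⊢; exact ⟨fun h => hzx h.symm, hyx.symm, hx⟩) h1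
        have he : ((R.erase x).erase y).erase z = ((R.erase y).erase z).erase x := by
          ext; simp; tauto
        rwa [he]
    · rw [Finset.not_nonempty_iff_eq_empty] at hne2
      have h1 := h x hx
      rw [hne2] at h1 ⊢
      rw [bw_false_empty] at h1
      rw [bw_true_empty]
      exact fun hw => h1 (hmono _ _ (Finset.subset_insert _ _) hw)

/-- Breaker can play on two disjoint boards separately. -/
theorem bw_split {w1 w2 : Finset V → Prop} (hm1 : ∀ A B, A ⊆ B → w1 A → w1 B)
    (hm2 : ∀ A B, A ⊆ B → w2 A → w2 B) (win : Finset V → Prop) (n : ℕ) :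
    ∀ (R1 R2 M1 M2 M : Finset V), (R1 ∪ R2).card = n → Disjoint R1 R2 →
      breakerWinsAux w1 true R1 M1 → breakerWinsAux w2 true R2 M2 →
      (∀ S1 S2, S1 ⊆ R1 → S2 ⊆ R2 → win (M ∪ (S1 ∪ S2)) → w1 (M1 ∪ S1) ∨ w2 (M2 ∪ S2)) →
      breakerWinsAux win true (R1 ∪ R2) M := by
  induction n using Nat.strong_induction_on with
  | _ n ih =>
    have key : ∀ (w1 w2 : Finset V → Prop), (∀ A B, A ⊆ B → w1 A → w1 B) →
        (∀ A B, A ⊆ B → w2 A → w2 B) →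
        (∀ m < n, ∀ (R1 R2 M1 M2 M : Finset V), (R1 ∪ R2).card = m → Disjoint R1 R2 →
          breakerWinsAux w1 true R1 M1 → breakerWinsAux w2 true R2 M2 →
          (∀ S1 S2, S1 ⊆ R1 → S2 ⊆ R2 → win (M ∪ (S1 ∪ S2)) → w1 (M1 ∪ S1) ∨ w2 (M2 ∪ S2)) →
          breakerWinsAux win true (R1 ∪ R2) M) →
        ∀ (R1 R2 M1 M2 M : Finset V), (R1 ∪ R2).card = n → Disjoint R1 R2 →
          breakerWinsAux w1 true R1 M1 → breakerWinsAux w2 true R2 M2 →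
          (∀ S1 S2, S1 ⊆ R1 → S2 ⊆ R2 → win (M ∪ (S1 ∪ S2)) → w1 (M1 ∪ S1) ∨ w2 (M2 ∪ S2)) →
          ∀ x ∈ R1, breakerWinsAux win false ((R1 ∪ R2).erase x) (insert x M) := by
      intro w1 w2 hm1 hm2 ih R1 R2 M1 M2 M hc hd h1 h2 hw x hx
      have hxu : x ∈ R1 ∪ R2 := Finset.mem_union_left _ hx
      have hx2 : x ∉ R2 := Finset.disjoint_left.1 hd hx
      rw [bw_true_ne ⟨x, hx⟩] at h1
      have h1 := h1 x hx
      have hcx : ((R1 ∪ R2).erase x).card < n := by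
        rw [← hc]; exact Finset.card_erase_lt_of_mem hxu
      by_cases hne : (R1.erase x).Nonempty
      · rw [bw_false_ne hne] at h1
        obtain ⟨y, hy, h1⟩ := h1
        have hyR := Finset.mem_of_mem_erase hy
        have hyx := Finset.ne_of_mem_erase hy
        have hy2 : y ∉ R2 := Finset.disjoint_left.1 hd hyR
        have hyu : y ∈ (R1 ∪ R2).erase x := by simp [hyx, hyR]
        rw [bw_false_ne ⟨y, hyu⟩]
        refine ⟨y, hyu, ?_⟩
        have he : ((R1 ∪ R2).erase x).erase y = (R1.erase x).erase y ∪ R2 := by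
          ext v; simp; grind
        rw [he]
        refine ih _ (lt_trans (Finset.card_erase_lt_of_mem hyu) hcx) _ _ (insert x M1) M2
          (insert x M) (by rw [he]) ?_ h1 h2 ?_
        · exact Finset.disjoint_of_subset_left
            ((Finset.erase_subset _ _).trans (Finset.erase_subset _ _)) hd
        · intro S1 S2 hS1 hS2 hwin
          have := hw (insert x S1) S2 ?_ hS2 ?_
          · rcases this with h | h
            · left; convert h using 1; ext; simp
            · right; exact h
          · intro v hv
            rcases Finset.mem_insert.1 hv with rfl | hv
            · exact hx
            · exact Finset.mem_of_mem_erase (Finset.mem_of_mem_erase (hS1 hv))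
          · convert hwin using 1; ext; simp
      · rw [Finset.not_nonempty_iff_eq_empty] at hne
        have hR1 : R1 = {x} := by
          ext v
          have : v ∉ R1.erase x := by rw [hne]; simp
          simp at this ⊢
          constructor
          · intro h; by_contra hh; exact this hh h
          · rintro rfl; exact hx
        have he : (R1 ∪ R2).erase x = R2 := by
          rw [hR1]; ext v; simp; grind
        rw [hne, bw_false_empty] at h1
        rw [he]
        have hw' : ∀ S1 S2, S1 ⊆ (∅ : Finset V) → S2 ⊆ R2 → win (insert x M ∪ (S1 ∪ S2)) →
            w1 (insert x M1 ∪ S1) ∨ w2 (M2 ∪ S2) := by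
          intro S1 S2 hS1 hS2 hwin
          have := hw (insert x S1) S2 ?_ hS2 ?_
          · rcases this with h | h
            · left; convert h using 1; ext; simp
            · right; exact h
          · intro v hv
            rcases Finset.mem_insert.1 hv with rfl | hv
            · exact hx
            · exact absurd (hS1 hv) (by simp)
          · convert hwin using 1; ext; simp
        by_cases hne2 : R2.Nonempty
        · rw [bw_false_ne hne2]
          obtain ⟨z, hz⟩ := hne2
          refine ⟨z, hz, ?_⟩
          have h3 := bw_erase hm2 _ R2 M2 z rfl hz h2
          have := ih (R2.erase z).card (by
            rw [he] at hcx; exact lt_trans (Finset.card_erase_lt_of_mem hz) hcx) ∅ (R2.erase z)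
            (insert x M1) M2 (insert x M) (by simp) (by simp) (bw_true_empty.2 h1) h3 ?_
          · simpa using this
          · intro S1 S2 hS1 hS2
            exact hw' S1 S2 hS1 (hS2.trans (Finset.erase_subset _ _))
        · rw [Finset.not_nonempty_iff_eq_empty] at hne2
          rw [hne2, bw_false_empty]
          rw [hne2, bw_true_empty] at h2
          intro hwin
          have := hw' ∅ ∅ (by simp) (by simp) (by simpa using hwin)
          simp at this
          tauto
    intro R1 R2 M1 M2 M hc hd h1 h2 hw
    by_cases hne : (R1 ∪ R2).Nonempty
    · rw [bw_true_ne hne]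
      intro x hx
      rcases Finset.mem_union.1 hx with hx | hx
      · exact key w1 w2 hm1 hm2 ih R1 R2 M1 M2 M hc hd h1 h2 hw x hx
      · rw [Finset.union_comm]
        refine key w2 w1 hm2 hm1 ?_ R2 R1 M2 M1 M (by rw [Finset.union_comm]; exact hc) hd.symm
          h2 h1 ?_ x hx
        · intro m hm R1 R2 M1 M2 M hc hd h1 h2 hw
          rw [Finset.union_comm]
          refine ih m hm R2 R1 M2 M1 M (by rw [Finset.union_comm]; exact hc) hd.symm h2 h1 ?_
          intro S1 S2 hS1 hS2 hh
          exact (hw S2 S1 hS2 hS1 (by rwa [Finset.union_comm S2 S1])).symm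
        · intro S1 S2 hS1 hS2 hh
          exact (hw S2 S1 hS2 hS1 (by rwa [Finset.union_comm S2 S1])).symm
    · rw [Finset.not_nonempty_iff_eq_empty, Finset.union_eq_empty] at hne
      obtain ⟨rfl, rfl⟩ := hne
      rw [bw_true_empty] at h1 h2
      simp only [Finset.union_empty]
      rw [bw_true_empty]
      intro hwin
      have := hw ∅ ∅ (by simp) (by simp) (by simpa using hwin)
      simp at this
      tauto

/-- Breaker prevents Maker from claiming a whole set with at least two elements. -/
theorem bw_pair (d : Finset V) (hd : 2 ≤ d.card) :
    breakerWinsAux (fun M => d ⊆ M) true d ∅ := by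
  have hne : d.Nonempty := by rw [← Finset.card_pos]; omega
  rw [bw_true_ne hne]
  intro x hx
  have hne2 : (d.erase x).Nonempty := by
    rw [← Finset.card_pos, Finset.card_erase_of_mem hx]; omega
  rw [bw_false_ne hne2]
  obtain ⟨y, hy⟩ := hne2
  refine ⟨y, hy, bw_of_never _ _ _ _ rfl ?_⟩
  intro S hS hdN
  have h1 := hdN (Finset.mem_of_mem_erase hy)
  have h2 : y ∉ S := fun h => by simpa using hS h
  simp [h2] at h1 hy
  tauto

theorem mono_edges (D : Finset (Finset V)) :
    ∀ A B : Finset V, A ⊆ B → (∃ d ∈ D, d ⊆ A) → (∃ d ∈ D, d ⊆ B) :=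
  fun _ _ h ⟨d, hd, hs⟩ => ⟨d, hd, hs.trans h⟩

/-- The pairing strategy, from an intermediate position. -/
theorem bw_pairing (D : Finset (Finset V)) : ∀ (R M : Finset V) (win : Finset V → Prop),
    (∀ d ∈ D, d ⊆ R) → (∀ d ∈ D, 2 ≤ d.card) →
    (∀ d ∈ D, ∀ d' ∈ D, d ≠ d' → Disjoint d d') →
    (∀ S ⊆ R, win (M ∪ S) → ∃ d ∈ D, d ⊆ S) →
    breakerWinsAux win true R M := by
  induction D using Finset.induction_on with
  | empty =>
    intro R M win _ _ _ hw
    apply bw_of_never _ _ _ _ rfl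
    intro S hS hwin
    simpa using hw S hS hwin
  | insert d D hdD ih =>
    intro R M win h1 h2 h3 hw
    have hdR : d ⊆ R := h1 d (by simp)
    have h2' := ih (R \ d) ∅ (fun M => ∃ d' ∈ D, d' ⊆ M) ?_ (fun d' hd' => h2 d' (by simp [hd']))
      (fun a ha b hb => h3 a (by simp [ha]) b (by simp [hb])) ?_
    · have h1' := bw_pair d (h2 d (by simp))
      have := bw_split (fun A B hAB h => h.trans hAB) (mono_edges D) win _ d (R \ d) ∅ ∅ M rfl
        Finset.disjoint_sdiff h1' h2' ?_
      · rwa [Finset.union_sdiff_of_subset hdR] at this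
      · intro S1 S2 hS1 hS2 hwin
        obtain ⟨d', hd', hs⟩ := hw (S1 ∪ S2)
          (Finset.union_subset (hS1.trans hdR) (hS2.trans Finset.sdiff_subset)) hwin
        rw [Finset.mem_insert] at hd'
        simp only [Finset.empty_union]
        rcases hd' with rfl | hd'
        · left
          intro v hv
          rcases Finset.mem_union.1 (hs hv) with h | h
          · exact h
          · exact absurd hv (Finset.mem_sdiff.1 (hS2 h)).2
        · right
          refine ⟨d', hd', ?_⟩
          intro v hv
          rcases Finset.mem_union.1 (hs hv) with h | h
          · exfalso
            have hne : d ≠ d' := fun h => hdD (h ▸ hd')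
            exact Finset.disjoint_left.1 (h3 d (by simp) d' (by simp [hd']) hne) (hS1 h) hv
          · exact h
    · intro d' hd' v hv
      rw [Finset.mem_sdiff]
      refine ⟨h1 d' (by simp [hd']) hv, fun h => ?_⟩
      have hne : d ≠ d' := fun h => hdD (h ▸ hd')
      exact Finset.disjoint_left.1 (h3 d (by simp) d' (by simp [hd']) hne) h hv
    · intro S _ h
      simpa using h

/-- Disjoint boards, in the form used below. -/
theorem breaker_split {X Y : Finset V} (hY : Y ⊆ X) {D1 D2 E : Finset (Finset V)}
    (h1 : BreakerWins (fun M => ∃ e ∈ D1, e ⊆ M) Y)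
    (h2 : BreakerWins (fun M => ∃ e ∈ D2, e ⊆ M) (X \ Y))
    (hE : ∀ e ∈ E, (∃ d ∈ D1, d ⊆ e ∧ d ⊆ Y) ∨ (∃ d ∈ D2, d ⊆ e ∧ d ⊆ X \ Y)) :
    BreakerWins (fun M => ∃ e ∈ E, e ⊆ M) X := by
  have := bw_split (mono_edges D1) (mono_edges D2) (fun M => ∃ e ∈ E, e ⊆ M) _ Y (X \ Y) ∅ ∅ ∅ rfl
        Finset.disjoint_sdiff h1 h2 ?_
  · rwa [Finset.union_sdiff_of_subset hY] at this
  · rintro S1 S2 hS1 hS2 ⟨e, he, hs⟩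
    simp only [Finset.empty_union] at hs ⊢
    rcases hE e he with ⟨d, hd, hde, hdY⟩ | ⟨d, hd, hde, hdY⟩
    · left
      refine ⟨d, hd, fun v hv => ?_⟩
      rcases Finset.mem_union.1 (hs (hde hv)) with h | h
      · exact h
      · exact absurd (hdY hv) (Finset.mem_sdiff.1 (hS2 h)).2
    · right
      refine ⟨d, hd, fun v hv => ?_⟩
      rcases Finset.mem_union.1 (hs (hde hv)) with h | h
      · exact absurd (hS1 h) (Finset.mem_sdiff.1 (hdY hv)).2
      · exact h

/-- The pairing strategy. -/
theorem breaker_pairing {X : Finset V} {E D : Finset (Finset V)}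
    (hDX : ∀ d ∈ D, d ⊆ X) (hD2 : ∀ d ∈ D, 2 ≤ d.card)
    (hdisj : ∀ d ∈ D, ∀ d' ∈ D, d ≠ d' → Disjoint d d')
    (hE : ∀ e ∈ E, ∃ d ∈ D, d ⊆ e) :
    BreakerWins (fun M => ∃ e ∈ E, e ⊆ M) X := by
  apply bw_pairing D X ∅ _ hDX hD2 hdisj
  rintro S _ ⟨e, he, hs⟩
  obtain ⟨d, hd, hde⟩ := hE e he
  exact ⟨d, hd, hde.trans (by simpa using hs)⟩

set_option maxHeartbeats 2000000 in
/-- Breaker wins on a hypergraph in which Breaker has a good answer to every first move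
of Maker (on a set of interesting vertices) leading to a pairing position. -/
theorem breaker_pasch {X : Finset V} {p q r z1 z2 z3 : V} (hX : {p, q, r, z1, z2, z3} ⊆ X)
    (hnd : [p, q, r, z1, z2, z3].Nodup) {E : Finset (Finset V)}
    (hE : ∀ e ∈ E, e = {p, z1, z3} ∨ e = {q, z1, z2} ∨ e = {r, z2, z3} ∨ e = {p, q, r}) :
    BreakerWins (fun M => ∃ e ∈ E, e ⊆ M) X := by
  set D : Finset (Finset V) := {{p, z1, z3}, {q, z1, z2}, {r, z2, z3}, {p, q, r}} with hD
  have key : ∀ (v w a b c d : V), {v, w, a, b, c, d} = ({p, q, r, z1, z2, z3} : Finset V) →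
      [v, w, a, b, c, d].Nodup →
      (∀ e ∈ D, w ∈ e ∨ {a, b} ⊆ e ∨ {c, d} ⊆ e) →
      breakerWinsAux (fun M => ∃ e ∈ D, e ⊆ M) false
        (Finset.erase {p, q, r, z1, z2, z3} v) (insert v ∅) := by
    intro v w a b c d hs hn he
    rw [← hs]
    simp only [List.nodup_cons, List.mem_cons, List.not_mem_nil, or_false, not_or,
      List.nodup_nil, and_true, not_false_eq_true] at hn
    have hw : w ∈ Finset.erase {v, w, a, b, c, d} v := by
      simp; tauto
    rw [bw_false_ne ⟨w, hw⟩]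
    refine ⟨w, hw, bw_pairing {{a, b}, {c, d}} _ _ _ ?_ ?_ ?_ ?_⟩
    · intro x hx
      rw [Finset.mem_insert, Finset.mem_singleton] at hx
      rcases hx with rfl | rfl
      · intro y; simp; grind
      · intro y; simp; grind
    · intro x hx
      rw [Finset.mem_insert, Finset.mem_singleton] at hx
      rcases hx with rfl | rfl
      · rw [Finset.card_pair (by tauto)]
      · rw [Finset.card_pair (by tauto)]
    · intro x hx y hy hxy
      rw [Finset.mem_insert, Finset.mem_singleton] at hx hy
      rw [Finset.disjoint_left]
      rcases hx with rfl | rfl <;> rcases hy with rfl | rfl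
      · exact absurd rfl hxy
      · intro y; simp; grind
      · intro y; simp; grind
      · exact absurd rfl hxy
    · rintro S hS ⟨e, heD, heS⟩
      have hvS : v ∉ S := fun h => by simpa using hS h
      have hwS : w ∉ S := fun h => by simpa using hS h
      rcases he e heD with h | h | h
      · have := heS h
        simp [hwS] at this
        tauto
      · refine ⟨{a, b}, by simp, fun y hy => ?_⟩
        have h1 := heS (h hy)
        simp at h1 hy
        grind
      · refine ⟨{c, d}, by simp, fun y hy => ?_⟩
        have h1 := heS (h hy)
        simp at h1 hy
        grind
  have main : BreakerWins (fun M => ∃ e ∈ D, e ⊆ M) {p, q, r, z1, z2, z3} := by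
    unfold BreakerWins
    rw [bw_true_ne ⟨p, by simp⟩]
    intro v hv
    simp only [List.nodup_cons, List.mem_cons, List.not_mem_nil, or_false, not_or,
      List.nodup_nil, and_true, not_false_eq_true] at hnd
    have hnd' : [p, z2, q, r, z1, z3].Nodup ∧ [q, z3, p, r, z1, z2].Nodup ∧
      [r, z1, p, q, z2, z3].Nodup ∧ [z1, r, p, z3, q, z2].Nodup ∧ [z2, p, q, z1, r, z3].Nodup ∧
      [z3, q, p, z1, r, z2].Nodup := by
      simp only [List.nodup_cons, List.mem_cons, List.not_mem_nil, or_false, not_or,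
        List.nodup_nil, and_true, not_false_eq_true]
      grind
    obtain ⟨n1, n2, n3, n4, n5, n6⟩ := hnd'
    have sub : ∀ a b : V, ∀ s : Finset V, {a, b} ⊆ s ↔ a ∈ s ∧ b ∈ s := by
      intro a b s; rw [Finset.insert_subset_iff, Finset.singleton_subset_iff]
    simp only [Finset.mem_insert, Finset.mem_singleton] at hv
    rcases hv with rfl | rfl | rfl | rfl | rfl | rfl
    · refine key _ _ _ _ _ _ ?_ n1 ?_
      · ext; simp; tauto
      · simp only [hD, Finset.mem_insert, Finset.mem_singleton, sub]
        rintro e (rfl | rfl | rfl | rfl) <;> simp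
    · refine key _ _ _ _ _ _ ?_ n2 ?_
      · ext; simp; tauto
      · simp only [hD, Finset.mem_insert, Finset.mem_singleton, sub]
        rintro e (rfl | rfl | rfl | rfl) <;> simp
    · refine key _ _ _ _ _ _ ?_ n3 ?_
      · ext; simp; tauto
      · simp only [hD, Finset.mem_insert, Finset.mem_singleton, sub]
        rintro e (rfl | rfl | rfl | rfl) <;> simp
    · refine key _ _ _ _ _ _ ?_ n4 ?_
      · ext; simp; tauto
      · simp only [hD, Finset.mem_insert, Finset.mem_singleton, sub]
        rintro e (rfl | rfl | rfl | rfl) <;> simp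
    · refine key _ _ _ _ _ _ ?_ n5 ?_
      · ext; simp; tauto
      · simp only [hD, Finset.mem_insert, Finset.mem_singleton, sub]
        rintro e (rfl | rfl | rfl | rfl) <;> simp
    · refine key _ _ _ _ _ _ ?_ n6 ?_
      · ext; simp; tauto
      · simp only [hD, Finset.mem_insert, Finset.mem_singleton, sub]
        rintro e (rfl | rfl | rfl | rfl) <;> simp
  refine breaker_split hX (D2 := ∅) main ?_ ?_
  · apply bw_of_never _ _ _ _ rfl
    simp
  · intro e he
    left
    refine ⟨e, by simpa [hD] using hE e he, subset_rfl, ?_⟩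
    rcases hE e he with rfl | rfl | rfl | rfl <;> (intro y; simp; tauto)

/-! ### Lists of edges -/

theorem mem_vset {l : List (Finset V)} {v : V} : v ∈ vset l ↔ ∃ e ∈ l, v ∈ e := by
  induction l with
  | nil => simp [vset]
  | cons a l ih =>
    have : vset (a :: l) = a ∪ vset l := rfl
    rw [this, Finset.mem_union, ih]; simp

theorem vset_nil : vset ([] : List (Finset V)) = ∅ := rfl

theorem vset_cons (a : Finset V) (l : List (Finset V)) : vset (a :: l) = a ∪ vset l := rfl

theorem vset_append (l l' : List (Finset V)) : vset (l ++ l') = vset l ∪ vset l' := by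
  ext v; simp only [mem_vset, Finset.mem_union, List.mem_append]; grind

theorem vset_perm {l l' : List (Finset V)} (h : l.Perm l') : vset l = vset l' := by
  ext v; simp only [mem_vset, h.mem_iff]

theorem vset_reverse (l : List (Finset V)) : vset l.reverse = vset l :=
  vset_perm (List.reverse_perm l)

theorem vset_singleton (a : Finset V) : vset [a] = a := by simp [vset]

theorem subset_vset {l : List (Finset V)} {e : Finset V} (h : e ∈ l) : e ⊆ vset l :=
  fun _ hv => mem_vset.2 ⟨e, h, hv⟩

theorem vset_subset {l : List (Finset V)} {W : Finset V} (h : ∀ e ∈ l, e ⊆ W) : vset l ⊆ W := by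
  intro v hv
  obtain ⟨e, he, hv⟩ := mem_vset.1 hv
  exact h e he hv

theorem getD_mem {l : List (Finset V)} {i : ℕ} (h : i < l.length) : l.getD i ∅ ∈ l := by
  rw [List.getD_eq_getElem _ _ h]; exact List.getElem_mem h

theorem exists_getD {l : List (Finset V)} {e : Finset V} (h : e ∈ l) :
    ∃ i < l.length, l.getD i ∅ = e := by
  obtain ⟨i, hi, he⟩ := List.getElem_of_mem h
  exact ⟨i, hi, by rw [List.getD_eq_getElem _ _ hi, he]⟩

theorem getD_snoc_lt {l : List (Finset V)} {e : Finset V} {i : ℕ} (h : i < l.length) :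
    (l ++ [e]).getD i ∅ = l.getD i ∅ := List.getD_append _ _ _ _ h

theorem getD_snoc_eq {l : List (Finset V)} {e : Finset V} :
    (l ++ [e]).getD l.length ∅ = e := by
  rw [List.getD_append_right _ _ _ _ le_rfl]; simp

theorem oldOf_snoc_lt {l : List (Finset V)} {e : Finset V} {i : ℕ} (h : i < l.length) :
    oldOf (l ++ [e]) i = oldOf l i := by
  unfold oldOf
  rw [getD_snoc_lt h, List.take_append_of_le_length h.le]

theorem oldOf_snoc_eq {l : List (Finset V)} {e : Finset V} :
    oldOf (l ++ [e]) l.length = e ∩ vset l := by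
  unfold oldOf
  rw [getD_snoc_eq, List.take_append_of_le_length le_rfl, List.take_length]

theorem valid_snoc {k : ℕ} {l : List (Finset V)} {e : Finset V} (hl : l ≠ []) :
    Valid k (l ++ [e]) ↔ Valid k l ∧ e ∉ l ∧ 1 ≤ (e ∩ vset l).card ∧ (e ∩ vset l).card ≤ k - 1 := by
  have hpos : 0 < l.length := List.length_pos_iff.2 hl
  constructor
  · rintro ⟨hn, h⟩
    rw [List.nodup_append] at hn
    refine ⟨⟨hn.1, fun i h0 hi => ?_⟩, ?_, ?_⟩
    · have := h i h0 (by simp; omega)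
      rwa [oldOf_snoc_lt hi] at this
    · intro he; exact hn.2.2 e he e (by simp) rfl
    · have := h l.length hpos (by simp)
      rwa [oldOf_snoc_eq] at this
  · rintro ⟨⟨hn, h⟩, he, h2⟩
    refine ⟨?_, fun i h0 hi => ?_⟩
    · rw [List.nodup_append]
      refine ⟨hn, by simp, ?_⟩
      intro a ha b hb
      simp at hb
      rintro rfl
      exact he (hb ▸ ha)
    · simp at hi
      by_cases hi' : i < l.length
      · rw [oldOf_snoc_lt hi']; exact h i h0 hi'
      · have : i = l.length := by omega
        rw [this, oldOf_snoc_eq]; exact h2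

theorem valid_singleton {k : ℕ} (e : Finset V) : Valid k [e] := by
  refine ⟨by simp, fun i h0 hi => ?_⟩
  simp at hi; omega

theorem valid_append {k : ℕ} (hk : 3 ≤ k) {L P : List (Finset V)} {a : Finset V} {v : V}
    (hL : Valid k L) (hL0 : L ≠ [])
    (hP : Valid k (a :: P)) (hc : ∀ e ∈ a :: P, e.card = k)
    (hv : vset L ∩ vset (a :: P) = {v}) (hva : v ∈ a) : Valid k (L ++ a :: P) := by
  have hvL : v ∈ vset L := by
    have : v ∈ vset L ∩ vset (a :: P) := by rw [hv]; simp
    exact (Finset.mem_inter.1 this).1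
  have hnot : ∀ e ∈ a :: P, e ∉ L := by
    intro e he heL
    have h1 : e ⊆ vset L ∩ vset (a :: P) :=
      Finset.subset_inter (subset_vset heL) (subset_vset he)
    have := Finset.card_le_card h1
    rw [hv, hc e he] at this
    simp at this; omega
  induction P using List.reverseRecOn with
  | nil =>
    rw [valid_snoc hL0]
    refine ⟨hL, hnot a (by simp), ?_⟩
    have : a ∩ vset L = {v} := by rw [← hv, vset_singleton, Finset.inter_comm]
    rw [this]; simp; omega
  | append_singleton P b ih =>
    have e1 : a :: (P ++ [b]) = (a :: P) ++ [b] := by simp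
    rw [e1] at hP hv hc hnot ⊢
    rw [valid_snoc (by simp)] at hP
    rw [← List.append_assoc, valid_snoc (by simp)]
    have hv' : vset L ∩ vset (a :: P) = {v} := by
      apply Finset.Subset.antisymm
      · rw [← hv, vset_append]
        exact Finset.inter_subset_inter_left Finset.subset_union_left
      · simp [hvL, vset_cons, hva]
    have hb : b ∩ vset (L ++ a :: P) = b ∩ vset (a :: P) := by
      rw [vset_append]
      ext y
      simp only [Finset.mem_inter, Finset.mem_union]
      constructor
      · rintro ⟨h1, h2 | h2⟩
        · have : y ∈ vset L ∩ vset (a :: P ++ [b]) := by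
            rw [vset_append, vset_singleton]; simp [h1, h2]
          rw [hv] at this
          simp at this
          subst this
          exact ⟨h1, by simp [vset_cons, hva]⟩
        · exact ⟨h1, h2⟩
      · tauto
    refine ⟨ih hP.1 (fun e he => hc e (by simp at he ⊢; tauto)) hv'
      (fun e he => hnot e (by simp at he ⊢; tauto)), ?_, ?_⟩
    · rw [List.mem_append]
      rintro (h | h)
      · exact hnot b (by simp) h
      · exact hP.2.1 h
    · rw [hb]; exact hP.2.2

theorem chain_iff {l : List (Finset V)} :
    Chain l ↔ l.IsChain (fun e f => (e ∩ f).Nonempty) := by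
  rw [List.isChain_iff_getElem]
  unfold Chain
  constructor
  · intro h i hi
    have := h i hi
    rwa [List.getD_eq_getElem _ _ hi, List.getD_eq_getElem _ _ (by omega)] at this
  · intro h i hi
    rw [List.getD_eq_getElem _ _ hi, List.getD_eq_getElem _ _ (by omega)]
    exact h i hi

theorem chain_append {L P : List (Finset V)} {c a : Finset V} {v : V}
    (hL : Chain (L ++ [c])) (hP : Chain (a :: P)) (hc : v ∈ c) (ha : v ∈ a) :
    Chain (L ++ [c] ++ a :: P) := by
  rw [chain_iff] at *
  rw [List.isChain_append]
  refine ⟨hL, hP, ?_⟩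
  intro x hx y hy
  simp at hx hy
  subst hx hy
  exact ⟨v, by simp [hc, ha]⟩

/-- A sufficient condition for validity shared by loose paths and loose cycles. -/
theorem valid_of_loose {k : ℕ} (hk : 3 ≤ k) {l : List (Finset V)} (hn : l.Nodup)
    (h1 : ∀ i j, i < j → j < l.length → (l.getD i ∅ ∩ l.getD j ∅).card ≤ 1)
    (h2 : ∀ i, i + 1 < l.length → (l.getD i ∅ ∩ l.getD (i + 1) ∅).card = 1)
    (h3 : ∀ i j, 0 < i → i + 1 < j → j < l.length → (l.getD i ∅ ∩ l.getD j ∅).card = 0) :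
    Valid k l ∧ Chain l := by
  refine ⟨⟨hn, ?_⟩, ?_⟩
  · intro i h0 hi
    have hmem : ∀ m < i, l.getD m ∅ ⊆ vset (l.take i) := by
      intro m hm
      apply subset_vset
      have hm' : m < (l.take i).length := by simp; omega
      have : (l.take i).getD m ∅ = l.getD m ∅ := by
        rw [List.getD_eq_getElem _ _ hm', List.getD_eq_getElem _ _ (by omega), List.getElem_take]
      rw [← this]
      exact getD_mem hm'
    constructor
    · obtain ⟨j, rfl⟩ : ∃ j, i = j + 1 := ⟨i - 1, by omega⟩
      have hs : l.getD j ∅ ∩ l.getD (j + 1) ∅ ⊆ oldOf l (j + 1) := by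
        unfold oldOf
        rw [Finset.inter_comm]
        exact Finset.inter_subset_inter_left (hmem j (by omega))
      have := Finset.card_le_card hs
      rwa [h2 j hi] at this
    · have hsub : oldOf l i ⊆ (l.getD (i - 1) ∅ ∩ l.getD i ∅) ∪ (l.getD 0 ∅ ∩ l.getD i ∅) := by
        intro v hv
        unfold oldOf at hv
        rw [Finset.mem_inter, mem_vset] at hv
        obtain ⟨hvi, e, he, hve⟩ := hv
        obtain ⟨m, hm, rfl⟩ := exists_getD he
        have hm2 : m < i := by simp at hm; omega
        have : (l.take i).getD m ∅ = l.getD m ∅ := by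
          rw [List.getD_eq_getElem _ _ hm, List.getD_eq_getElem _ _ (by omega), List.getElem_take]
        rw [this] at hve
        by_cases hm0 : m = 0
        · subst hm0; simp only [Finset.mem_union, Finset.mem_inter]; tauto
        · by_cases hm1 : m + 1 = i
          · subst hm1; simp only [Finset.mem_union, Finset.mem_inter, Nat.add_sub_cancel]; tauto
          · have := h3 m i (by omega) (by omega) hi
            rw [Finset.card_eq_zero] at this
            have hh : v ∈ l.getD m ∅ ∩ l.getD i ∅ := by rw [Finset.mem_inter]; exact ⟨hve, hvi⟩
            rw [this] at hh
            simp at hh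
      have a1 := Finset.card_le_card hsub
      have a2 := Finset.card_union_le (l.getD (i - 1) ∅ ∩ l.getD i ∅) (l.getD 0 ∅ ∩ l.getD i ∅)
      have a3 := h1 (i - 1) i (by omega) hi
      have a4 := h1 0 i h0 hi
      omega
  · intro i hi
    rw [← Finset.card_pos, h2 i hi]; omega

theorem LooseCycle.valid {k : ℕ} (hk : 3 ≤ k) {l : List (Finset V)} (h : LooseCycle l) :
    Valid k l ∧ Chain l := by
  obtain ⟨hlen, hn, h⟩ := h
  apply valid_of_loose hk hn
  · intro i j hij hj
    rw [h i j hij hj]; split_ifs <;> omega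
  · intro i hi
    rw [h i (i + 1) (by omega) hi]; simp
  · intro i j h0 hij hj
    rw [h i j (by omega) hj]
    rw [if_neg]; omega

theorem LoosePath.valid {k : ℕ} (hk : 3 ≤ k) {l : List (Finset V)} (h : LoosePath l) :
    Valid k l ∧ Chain l := by
  obtain ⟨hlen, hn, h⟩ := h
  apply valid_of_loose hk hn
  · intro i j hij hj
    rw [h i j hij hj]; split_ifs <;> omega
  · intro i hi
    rw [h i (i + 1) (by omega) hi]; simp
  · intro i j h0 hij hj
    rw [h i j (by omega) hj]
    rw [if_neg]; omega

theorem overlap_mk {k : ℕ} {e f : Finset V} (hef : e ≠ f) (he : e.card = k) (hf : f.card = k)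
    (h2 : 2 ≤ (e ∩ f).card) : OverlapPair k [e, f] := by
  refine ⟨e, f, rfl, hef, h2, ?_⟩
  have : (e ∩ f).card < k := by
    rw [← he]
    apply Finset.card_lt_card
    refine ⟨Finset.inter_subset_left, fun h => hef ?_⟩
    apply Finset.eq_of_subset_of_card_le
    · exact h.trans Finset.inter_subset_right
    · omega
  omega

theorem OPorLC.valid {k : ℕ} (hk : 3 ≤ k) {l : List (Finset V)} (h : OPorLC k l) :
    Valid k l ∧ Chain l := by
  rcases h with ⟨e, f, rfl, hne, h1, h2⟩ | h
  · constructor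
    · have : [e, f] = [e] ++ [f] := rfl
      rw [this, valid_snoc (by simp)]
      refine ⟨valid_singleton e, by simpa using hne.symm, ?_⟩
      rw [vset_singleton, Finset.inter_comm]
      omega
    · rw [chain_iff]
      simp only [List.isChain_cons_cons, List.isChain_singleton, and_true]
      rw [← Finset.card_pos]; omega
  · exact h.valid hk

theorem looseCycle_rot1 {a : Finset V} {l : List (Finset V)} (h : LooseCycle (a :: l)) :
    LooseCycle (l ++ [a]) := by
  obtain ⟨hlen, hn, h⟩ := h
  simp only [List.length_cons] at hlen h
  refine ⟨by simpa using hlen, ?_, ?_⟩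
  · exact (List.perm_append_singleton a l).nodup_iff.2 hn
  · intro i j hij hj
    simp only [List.length_append, List.length_cons, List.length_nil] at hj ⊢
    by_cases hjl : j < l.length
    · rw [getD_snoc_lt hjl, getD_snoc_lt (by omega)]
      have := h (i + 1) (j + 1) (by omega) (by omega)
      simp only [List.getD_cons_succ] at this
      rw [this]
      congr 1
      apply propext; omega
    · have hj' : j = l.length := by omega
      subst hj'
      rw [getD_snoc_eq, getD_snoc_lt hij]
      have := h 0 (i + 1) (by omega) (by omega)
      simp only [List.getD_cons_succ, List.getD_cons_zero] at this
      rw [Finset.inter_comm, this]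
      refine if_congr ?_ rfl rfl
      simp only [true_and]
      omega

theorem OPorLC.rot1 {k : ℕ} {a : Finset V} {l : List (Finset V)} (h : OPorLC k (a :: l)) :
    OPorLC k (l ++ [a]) := by
  rcases h with ⟨e, f, hl, hne, h1, h2⟩ | h
  · left
    simp at hl
    obtain ⟨rfl, rfl⟩ := hl
    exact ⟨f, a, rfl, hne.symm, by rwa [Finset.inter_comm], by rwa [Finset.inter_comm]⟩
  · right; exact looseCycle_rot1 h

theorem OPorLC.rot {k : ℕ} (l₁ : List (Finset V)) : ∀ {l₂ : List (Finset V)},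
    OPorLC k (l₁ ++ l₂) → OPorLC k (l₂ ++ l₁) := by
  induction l₁ with
  | nil => intro l₂ h; simpa using h
  | cons a l ih =>
    intro l₂ h
    have := OPorLC.rot1 (a := a) (l := l ++ l₂) (by simpa using h)
    have := ih (l₂ := l₂ ++ [a]) (by simpa using this)
    simpa using this

theorem looseCycle_rot (l₁ : List (Finset V)) : ∀ {l₂ : List (Finset V)},
    LooseCycle (l₁ ++ l₂) → LooseCycle (l₂ ++ l₁) := by
  induction l₁ with
  | nil => intro l₂ h; simpa using h
  | cons a l ih =>
    intro l₂ h
    have := looseCycle_rot1 (a := a) (l := l ++ l₂) (by simpa using h)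
    have := ih (l₂ := l₂ ++ [a]) (by simpa using this)
    simpa using this

theorem OPorLC.end_at {k : ℕ} {l : List (Finset V)} (h : OPorLC k l) {v : V} (hv : v ∈ vset l) :
    ∃ L c, OPorLC k (L ++ [c]) ∧ v ∈ c ∧ (L ++ [c]).Perm l := by
  obtain ⟨c, hc, hvc⟩ := mem_vset.1 hv
  obtain ⟨s, t, rfl⟩ := List.append_of_mem hc
  refine ⟨t ++ s, c, ?_, hvc, ?_⟩
  · have := OPorLC.rot (s ++ [c]) (l₂ := t) (by simpa using h)
    simpa using this
  · rw [List.append_assoc]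
    refine List.perm_append_comm.trans ?_
    simp

theorem LooseCycle.end_at {l : List (Finset V)} (h : LooseCycle l) {v : V} (hv : v ∈ vset l) :
    ∃ L c, LooseCycle (L ++ [c]) ∧ v ∈ c ∧ (L ++ [c]).Perm l := by
  obtain ⟨c, hc, hvc⟩ := mem_vset.1 hv
  obtain ⟨s, t, rfl⟩ := List.append_of_mem hc
  refine ⟨t ++ s, c, ?_, hvc, ?_⟩
  · have := looseCycle_rot (s ++ [c]) (l₂ := t) (by simpa using h)
    simpa using this
  · rw [List.append_assoc]
    refine List.perm_append_comm.trans ?_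
    simp

theorem OPorLC.start_at {k : ℕ} {l : List (Finset V)} (h : OPorLC k l) {v : V} (hv : v ∈ vset l) :
    ∃ L c, OPorLC k (c :: L) ∧ v ∈ c ∧ (c :: L).Perm l := by
  obtain ⟨c, hc, hvc⟩ := mem_vset.1 hv
  obtain ⟨s, t, rfl⟩ := List.append_of_mem hc
  refine ⟨t ++ s, c, ?_, hvc, ?_⟩
  · have := OPorLC.rot s (l₂ := c :: t) h
    simpa using this
  · have : c :: (t ++ s) = (c :: t) ++ s := by simp
    rw [this]
    exact List.perm_append_comm

/-- Recursive form of loose paths. -/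
def LP : List (Finset V) → Prop
  | [] => True
  | [_] => True
  | f :: e :: l => (f ∩ e).card = 1 ∧ f ∩ vset l = ∅ ∧ LP (e :: l)

theorem LP.tail {a : Finset V} {l : List (Finset V)} (h : LP (a :: l)) : LP l := by
  cases l with
  | nil => trivial
  | cons b l => exact h.2.2

theorem LP.loosePath {k : ℕ} (hk : 3 ≤ k) {l : List (Finset V)} (h : LP l) (h0 : l ≠ [])
    (hc : ∀ e ∈ l, e.card = k) : LoosePath l := by
  refine ⟨h0, ?_⟩
  clear h0
  induction l with
  | nil => simp
  | cons f l ih =>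
    obtain ⟨hn, ih⟩ := ih h.tail (fun e he => hc e (by simp [he]))
    cases l with
    | nil => simp; intros; omega
    | cons e l =>
      obtain ⟨h1, h2, -⟩ := h
      have hf := hc f (by simp)
      constructor
      · rw [List.nodup_cons]
        refine ⟨?_, hn⟩
        rw [List.mem_cons]
        rintro (rfl | hfl)
        · rw [Finset.inter_self] at h1; omega
        · have := subset_vset hfl
          rw [Finset.inter_eq_left.2 this] at h2
          subst h2; simp at hf; omega
      · intro i j hij hj
        obtain ⟨j, rfl⟩ : ∃ j', j = j' + 1 := ⟨j - 1, by omega⟩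
        cases i with
        | zero =>
          cases j with
          | zero => simpa using h1
          | succ j =>
            simp only [List.getD_cons_succ, List.getD_cons_zero]
            rw [if_neg (by omega), Finset.card_eq_zero]
            have hs : f ∩ l.getD j ∅ ⊆ f ∩ vset l := by
              refine Finset.inter_subset_inter_left (subset_vset (getD_mem ?_))
              simp at hj; omega
            rw [h2] at hs
            exact Finset.subset_empty.1 hs
        | succ i =>
          have := ih i j (by omega) (by simpa using hj)
          simp only [List.getD_cons_succ] at this ⊢
          rw [this]
          congr 1
          apply propext; omega

theorem LP.snoc {f e : Finset V} (l : List (Finset V)) (h : LP (l ++ [e])) (h1 : (e ∩ f).card = 1)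
    (h2 : f ∩ vset l = ∅) : LP (l ++ [e, f]) := by
  induction l with
  | nil => exact ⟨h1, by simp [vset_nil], trivial⟩
  | cons a l ih =>
    have h2' : f ∩ a = ∅ ∧ f ∩ vset l = ∅ := by
      rw [vset_cons, Finset.inter_union_distrib_left, Finset.union_eq_empty] at h2
      exact h2
    have := ih h.tail h2'.2
    cases l with
    | nil =>
      obtain ⟨h3, h4, -⟩ := h
      refine ⟨h3, ?_, this⟩
      rw [vset_singleton, Finset.inter_comm]
      exact h2'.1
    | cons b l =>
      obtain ⟨h3, h4, -⟩ := h
      refine ⟨h3, ?_, this⟩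
      have : a ∩ f = ∅ := by rw [Finset.inter_comm]; exact h2'.1
      change a ∩ vset (l ++ [e]) = ∅ at h4
      change a ∩ vset (l ++ [e, f]) = ∅
      rw [vset_append] at h4 ⊢
      rw [vset_singleton] at h4
      simp only [vset_cons, vset_nil, Finset.inter_union_distrib_left, Finset.union_eq_empty] at h4 ⊢
      simp [this, h4]

theorem LP.reverse {l : List (Finset V)} (h : LP l) : LP l.reverse := by
  induction l with
  | nil => trivial
  | cons f l ih =>
    cases l with
    | nil => trivial
    | cons e l =>
      obtain ⟨h1, h2, h3⟩ := h
      have := LP.snoc (f := f) (e := e) l.reverse (by simpa using ih h3)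
        (by rwa [Finset.inter_comm]) (by rwa [vset_reverse])
      simpa using this

theorem LP.prefix {l₂ : List (Finset V)} (l₁ : List (Finset V)) (h : LP (l₁ ++ l₂)) : LP l₁ := by
  induction l₁ with
  | nil => trivial
  | cons f l ih =>
    cases l with
    | nil => trivial
    | cons e l =>
      obtain ⟨h1, h2, h3⟩ := h
      refine ⟨h1, ?_, ih h3⟩
      change f ∩ vset (l ++ l₂) = ∅ at h2
      rw [vset_append, Finset.inter_union_distrib_left, Finset.union_eq_empty] at h2
      exact h2.1

/-- Closing up a loose path gives a loose cycle. -/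
theorem looseCycle_of_path {k : ℕ} (hk : 3 ≤ k) {c f b : Finset V} {m : List (Finset V)}
    (hp : LP (f :: (m ++ [b]))) (hc : ∀ e ∈ f :: (m ++ [b]), e.card = k) (hck : c.card = k)
    (h1 : (c ∩ f).card = 1) (h2 : (c ∩ b).card = 1) (h3 : c ∩ vset m = ∅) :
    LooseCycle (c :: f :: (m ++ [b])) := by
  obtain ⟨-, hn, hi⟩ := hp.loosePath hk (by simp) hc
  refine ⟨by simp, ?_, ?_⟩
  · rw [List.nodup_cons]
    refine ⟨?_, hn⟩
    simp only [List.mem_cons, List.mem_append, List.not_mem_nil, or_false]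
    rintro (rfl | h | rfl)
    · rw [Finset.inter_self] at h1; omega
    · have := subset_vset h
      rw [Finset.inter_eq_left.2 this] at h3
      subst h3; simp at hck; omega
    · rw [Finset.inter_self] at h2; omega
  · intro i j hij hj
    obtain ⟨j, rfl⟩ : ∃ j', j = j' + 1 := ⟨j - 1, by omega⟩
    simp only [List.length_cons, List.length_append, List.length_nil] at hj ⊢
    cases i with
    | zero =>
      cases j with
      | zero => simpa using h1
      | succ j =>
        simp only [List.getD_cons_succ, List.getD_cons_zero]
        by_cases hjm : j < m.length
        · rw [if_neg (by omega), getD_snoc_lt hjm, Finset.card_eq_zero]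
          have hs : c ∩ m.getD j ∅ ⊆ c ∩ vset m :=
            Finset.inter_subset_inter_left (subset_vset (getD_mem hjm))
          rw [h3] at hs
          exact Finset.subset_empty.1 hs
        · have : j = m.length := by omega
          subst this
          rw [if_pos (Or.inr ⟨trivial, by omega⟩), getD_snoc_eq]
          exact h2
    | succ i =>
      have := hi i j (by omega) (by simp; omega)
      simp only [List.getD_cons_succ] at this ⊢
      rw [this]
      congr 1
      apply propext; omega


theorem perm_mem_of {E : Finset (Finset V)} {l l' : List (Finset V)} (h : l.Perm l')
    (hl : ∀ c ∈ l', c ∈ E) : ∀ c ∈ l, c ∈ E := fun c hc => hl c (h.mem_iff.1 hc)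

theorem inter_card_le {k : ℕ} {h W : Finset V} (hc : h.card = k) (hn : ¬ h ⊆ W) :
    (h ∩ W).card ≤ k - 1 := by
  have : (h ∩ W).card < h.card := by
    apply Finset.card_lt_card
    refine ⟨Finset.inter_subset_left, fun h' => hn (h'.trans Finset.inter_subset_right)⟩
  omega

theorem bicycle_handle {k : ℕ} (hk : 3 ≤ k) {E : Finset (Finset V)} (hu : Uniform k E)
    {C : List (Finset V)} (hC : OPorLC k C) (hCE : ∀ c ∈ C, c ∈ E) {h : Finset V} (hh : h ∈ E)
    (h2 : 2 ≤ (h ∩ vset C).card) (h3 : ¬ h ⊆ vset C) : ContainsBicycle k E := by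
  obtain ⟨v, hv⟩ := Finset.card_pos.1 (show 0 < (h ∩ vset C).card by omega)
  rw [Finset.mem_inter] at hv
  obtain ⟨L, c, hL, hvc, hp⟩ := hC.end_at hv.2
  obtain ⟨hval, hch⟩ := hL.valid hk
  have hvs := vset_perm hp
  have hle := inter_card_le (hu h hh) h3
  have hE := perm_mem_of hp hCE
  refine ⟨L ++ [c] ++ [h], ?_, Or.inr (Or.inr (Or.inr (Or.inl ⟨?_, ?_, L ++ [c], h, rfl, hL, ?_⟩)))⟩
  · intro e he
    rw [List.mem_toFinset, List.mem_append] at he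
    rcases he with he | he
    · exact hE e he
    · simp at he; exact he ▸ hh
  · rw [valid_snoc (by simp), hvs]
    refine ⟨hval, ?_, by omega, hle⟩
    intro hm
    exact h3 (subset_vset (hp.mem_iff.1 hm))
  · exact chain_append hch (chain_iff.2 (by simp)) hvc hv.1
  · have : (L ++ [c] ++ [h]).length - 1 = (L ++ [c]).length := by simp
    rw [this]
    unfold BadAt
    rw [oldOf_snoc_eq, hvs]
    exact ⟨h2, hle⟩

/-- Reversed loose paths leaving the set `K` through the edge `e1`. -/
def RP (K : Finset V) (e1 : Finset V) : List (Finset V) → Prop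
  | [] => True
  | [e] => e = e1
  | f :: e :: l => (f ∩ e).card = 1 ∧ f ∩ (K ∪ vset l) = ∅ ∧ RP K e1 (e :: l)

theorem RP.tail {K e1 a : Finset V} {l : List (Finset V)} (h : RP K e1 (a :: l)) : RP K e1 l := by
  cases l with
  | nil => trivial
  | cons b l => exact h.2.2

theorem RP.suffix {K e1 : Finset V} {l : List (Finset V)} (s : List (Finset V))
    (h : RP K e1 (s ++ l)) : RP K e1 l := by
  induction s with
  | nil => exact h
  | cons a s ih => exact ih h.tail

theorem RP.lp {K e1 : Finset V} {l : List (Finset V)} (h : RP K e1 l) : LP l := by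
  induction l with
  | nil => trivial
  | cons f l ih =>
    cases l with
    | nil => trivial
    | cons e l =>
      obtain ⟨h1, h2, h3⟩ := h
      refine ⟨h1, ?_, ih h3⟩
      rw [Finset.inter_union_distrib_left, Finset.union_eq_empty] at h2
      exact h2.2

theorem RP.head_card {K e1 e : Finset V} {l : List (Finset V)} (h1 : (e1 ∩ K).card = 1)
    (h : RP K e1 (e :: l)) : (e ∩ (K ∪ vset l)).card = 1 := by
  cases l with
  | nil =>
    have : e = e1 := h
    subst this
    simpa [vset_nil] using h1
  | cons f l =>
    obtain ⟨h1, h2, h3⟩ := h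
    rw [vset_cons]
    have : e ∩ (K ∪ (f ∪ vset l)) = e ∩ f := by
      have : K ∪ (f ∪ vset l) = f ∪ (K ∪ vset l) := by
        ext; simp only [Finset.mem_union]; tauto
      rw [this, Finset.inter_union_distrib_left, h2, Finset.union_empty]
    rw [this, h1]

theorem RP.last {K e1 : Finset V} {l : List (Finset V)} (h : RP K e1 l) (h0 : l ≠ []) :
    ∃ m, l = m ++ [e1] ∧ vset m ∩ K = ∅ := by
  induction l with
  | nil => exact absurd rfl h0
  | cons f l ih =>
    cases l with
    | nil =>
      have : f = e1 := h
      subst this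
      exact ⟨[], rfl, by simp [vset_nil]⟩
    | cons e l =>
      obtain ⟨m, hm, hm2⟩ := ih h.tail (by simp)
      refine ⟨f :: m, by simp [hm], ?_⟩
      obtain ⟨h1, h2, h3⟩ := h
      rw [Finset.inter_union_distrib_left, Finset.union_eq_empty] at h2
      rw [vset_cons, Finset.union_inter_distrib_right, hm2, h2.1, Finset.union_empty]

theorem RP.inter_K {K e1 : Finset V} {l : List (Finset V)} (h : RP K e1 l) (h0 : l ≠ []) :
    K ∩ vset l = K ∩ e1 := by
  obtain ⟨m, rfl, hm⟩ := h.last h0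
  rw [vset_append, vset_singleton, Finset.inter_union_distrib_left, Finset.inter_comm K, hm,
    Finset.empty_union]

theorem RP.disj {K e1 a : Finset V} {s t : List (Finset V)} (h : RP K e1 (s ++ a :: t)) :
    vset s ∩ (K ∪ vset t) = ∅ := by
  induction s with
  | nil => simp [vset_nil]
  | cons f s ih =>
    have ih := ih h.tail
    rw [vset_cons, Finset.union_inter_distrib_right, ih, Finset.union_empty]
    have key : f ∩ (K ∪ vset t) = ∅ := by
      cases s with
      | nil => exact h.2.1
      | cons e s =>
        have h2 := h.2.1
        change f ∩ (K ∪ vset (s ++ a :: t)) = ∅ at h2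
        rw [← Finset.subset_empty, ← h2]
        apply Finset.inter_subset_inter_left
        rw [vset_append, vset_cons]
        intro x; simp only [Finset.mem_union]; tauto
    exact key

theorem card_one_mem {A B : Finset V} (h : (A ∩ B).card = 1) : ∃ v, A ∩ B = {v} ∧ v ∈ A ∧ v ∈ B := by
  obtain ⟨v, hv⟩ := Finset.card_eq_one.1 h
  have : v ∈ A ∩ B := by rw [hv]; simp
  exact ⟨v, hv, (Finset.mem_inter.1 this).1, (Finset.mem_inter.1 this).2⟩

theorem bicycle_hang {k : ℕ} (hk : 3 ≤ k) {E : Finset (Finset V)} (hu : Uniform k E)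
    {C : List (Finset V)} (hC : OPorLC k C) (hCE : ∀ c ∈ C, c ∈ E) {e1 : Finset V}
    (h1 : (e1 ∩ vset C).card = 1) {l : List (Finset V)} (hl : RP (vset C) e1 l)
    (hlE : ∀ c ∈ l, c ∈ E) {P : List (Finset V)} (hP : OPorLC k P) (hPE : ∀ c ∈ P, c ∈ E)
    (hPU : (vset P ∩ (vset C ∪ vset l)).card = 1) : ContainsBicycle k E := by
  induction l with
  | nil =>
    rw [vset_nil, Finset.union_empty] at hPU
    obtain ⟨v, hv, hvP, hvC⟩ := card_one_mem hPU
    obtain ⟨L, c, hL, hvc, hp⟩ := hC.end_at hvC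
    obtain ⟨M, d, hM, hvd, hq⟩ := hP.start_at hvP
    obtain ⟨val1, ch1⟩ := hL.valid hk
    obtain ⟨val2, ch2⟩ := hM.valid hk
    have hqE := perm_mem_of hq hPE
    have hpE := perm_mem_of hp hCE
    have hcap : vset (L ++ [c]) ∩ vset (d :: M) = {v} := by
      rw [vset_perm hp, vset_perm hq, Finset.inter_comm, hv]
    refine ⟨L ++ [c] ++ d :: M, ?_, Or.inr (Or.inr (Or.inr (Or.inr
      ⟨?_, ?_, L ++ [c], [], d :: M, by simp, hL, hM, Or.inl ⟨rfl, ?_⟩⟩)))⟩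
    · intro e he
      rw [List.mem_toFinset, List.mem_append] at he
      rcases he with he | he
      · exact hpE e he
      · exact hqE e he
    · exact valid_append hk val1 (by simp) val2 (fun e he => hu e (hqE e he)) hcap hvd
    · exact chain_append ch1 ch2 hvc hvd
    · rw [hcap]; simp
  | cons e l ih =>
    by_cases hne : (vset P ∩ (vset C ∪ vset l)).card = 1
    · exact ih hl.tail (fun c hc => hlE c (by simp [hc])) hne
    clear ih
    have hsub : vset P ∩ (vset C ∪ vset l) ⊆ vset P ∩ (vset C ∪ vset (e :: l)) := by
      apply Finset.inter_subset_inter_left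
      rw [vset_cons]; intro x; simp only [Finset.mem_union]; tauto
    have hemp : vset P ∩ (vset C ∪ vset l) = ∅ := by
      have := Finset.card_le_card hsub
      rw [← Finset.card_eq_zero]; omega
    have hemp2 := hemp
    rw [Finset.inter_union_distrib_left, Finset.union_eq_empty] at hemp2
    obtain ⟨v, hv, hvP, hvU⟩ := card_one_mem hPU
    have hPe : vset P ∩ e = {v} := by
      rw [← hv, vset_cons]
      have : vset C ∪ (e ∪ vset l) = e ∪ (vset C ∪ vset l) := by
        ext; simp only [Finset.mem_union]; tauto
      rw [this, Finset.inter_union_distrib_left, hemp, Finset.union_empty]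
    have hve : v ∈ e := by
      have : v ∈ vset P ∩ e := by rw [hPe]; simp
      exact (Finset.mem_inter.1 this).2
    obtain ⟨m, hm, hmK⟩ := hl.last (by simp)
    obtain ⟨x, hx, hxe, hxK⟩ := card_one_mem h1
    obtain ⟨L, c, hL, hxc, hp⟩ := hC.end_at hxK
    obtain ⟨M, d, hM, hvd, hq⟩ := hP.start_at hvP
    obtain ⟨val1, ch1⟩ := hL.valid hk
    obtain ⟨val2, ch2⟩ := hM.valid hk
    have hqE := perm_mem_of hq hPE
    have hpE := perm_mem_of hp hCE
    have hR1 : (e :: l).reverse = e1 :: m.reverse := by rw [hm]; simp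
    have hR2 : (e :: l).reverse = l.reverse ++ [e] := by simp
    have hRE : ∀ c ∈ (e :: l).reverse, c ∈ E := fun c hc => hlE c (List.mem_reverse.1 hc)
    have hLP : LoosePath (e :: l).reverse :=
      hl.lp.reverse.loosePath hk (by simp) (fun c hc => hu c (hRE c hc))
    obtain ⟨valR, chR⟩ := hLP.valid hk
    have hcap1 : vset (L ++ [c]) ∩ vset (e :: l).reverse = {x} := by
      rw [vset_reverse, vset_perm hp, hl.inter_K (by simp), Finset.inter_comm, hx]
    have hcap2 : vset (L ++ [c]) ∩ vset (d :: M) = ∅ := by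
      rw [vset_perm hp, vset_perm hq, Finset.inter_comm, hemp2.1]
    have hcap3 : vset (e :: l).reverse ∩ vset (d :: M) = {v} := by
      rw [vset_reverse, vset_perm hq, Finset.inter_comm, vset_cons,
        Finset.inter_union_distrib_left, hPe, hemp2.2, Finset.union_empty]
    have valA : Valid k (L ++ [c] ++ (e :: l).reverse) := by
      rw [hR1] at valR hRE hcap1 ⊢
      exact valid_append hk val1 (by simp) valR (fun e he => hu e (hRE e he)) hcap1 hxe
    have chA : Chain (L ++ [c] ++ (e :: l).reverse) := by
      rw [hR1] at chR ⊢
      exact chain_append ch1 chR hxc hxe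
    refine ⟨L ++ [c] ++ (e :: l).reverse ++ d :: M, ?_, Or.inr (Or.inr (Or.inr (Or.inr
      ⟨?_, ?_, L ++ [c], (e :: l).reverse, d :: M, rfl, hL, hM,
        Or.inr ⟨by simp, hLP, ?_, hcap2, ?_, ?_⟩⟩)))⟩
    · intro e he
      rw [List.mem_toFinset, List.mem_append, List.mem_append] at he
      rcases he with (he | he) | he
      · exact hpE e he
      · exact hRE e he
      · exact hqE e he
    · refine valid_append hk valA (by simp) val2 (fun e he => hu e (hqE e he)) ?_ hvd
      rw [vset_append, Finset.union_inter_distrib_right, hcap2, hcap3, Finset.empty_union]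
    · rw [hR2, ← List.append_assoc] at chA ⊢
      exact chain_append chA ch2 hve hvd
    · rw [hcap1]; simp
    · rw [hcap3]; simp
    · intro hlen
      rw [vset_perm hp, vset_perm hq]
      constructor
      · rw [hR1] at hlen ⊢
        rw [List.getD_cons_succ]
        refine Finset.subset_empty.1 (Finset.Subset.trans ?_ hmK.subset)
        have hlen' : 0 < m.reverse.length := by simp at hlen ⊢; omega
        apply Finset.inter_subset_inter_right
        rw [← vset_reverse m]
        exact subset_vset (getD_mem hlen')
      · rw [hR2] at hlen ⊢
        have hl' : (l.reverse ++ [e]).length - 2 < l.reverse.length := by simp at hlen ⊢; omega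
        rw [getD_snoc_lt hl', Finset.inter_comm]
        refine Finset.subset_empty.1 (Finset.Subset.trans ?_ hemp2.2.subset)
        apply Finset.inter_subset_inter_left
        rw [← vset_reverse l]
        exact subset_vset (getD_mem hl')


theorem exists_first {z : V} {l : List (Finset V)} (h : z ∈ vset l) :
    ∃ s a t, l = s ++ a :: t ∧ z ∈ a ∧ z ∉ vset s := by
  induction l with
  | nil => simp [vset_nil] at h
  | cons b l ih =>
    by_cases hb : z ∈ b
    · exact ⟨[], b, l, rfl, hb, by simp [vset_nil]⟩
    · rw [vset_cons, Finset.mem_union] at h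
      obtain ⟨s, a, t, rfl, ha, hs⟩ := ih (h.resolve_left hb)
      refine ⟨b :: s, a, t, rfl, ha, ?_⟩
      rw [vset_cons, Finset.mem_union]
      tauto

/-- The edge `f` prevents the path `l` from being extended. -/
def Failing (E : Finset (Finset V)) (K e1 : Finset V) (l : List (Finset V)) (f : Finset V) : Prop :=
  RP K e1 l ∧ l ≠ [] ∧ (∀ c ∈ l, c ∈ E) ∧ f ∈ E ∧ f ∉ l ∧ ¬ f ⊆ K ∧ 2 ≤ (f ∩ (K ∪ vset l)).card

theorem exists_failing {k : ℕ} (hk : 3 ≤ k) {E : Finset (Finset V)} (hu : Uniform k E)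
    (hT : ∀ a b : V, a ≠ b → ∀ e0 ∈ E, a ∈ e0 → ∃ e ∈ E, ¬ (a ∈ e ↔ b ∈ e))
    {K e1 : Finset V} (he1 : e1 ∈ E) (h1 : (e1 ∩ K).card = 1) : ∃ l f, Failing E K e1 l f := by
  by_contra hno
  push Not at hno
  have hext : ∀ n : ℕ, ∃ l, RP K e1 l ∧ l.length = n + 1 ∧ ∀ c ∈ l, c ∈ E := by
    intro n
    induction n with
    | zero => exact ⟨[e1], rfl, rfl, by simpa using he1⟩
    | succ n ih =>
      obtain ⟨l, hl, hlen, hlE⟩ := ih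
      cases l with
      | nil => simp at hlen
      | cons e l =>
        have hc := hl.head_card h1
        have heE := hlE e (by simp)
        have hck := hu e heE
        have h2 : 1 < (e \ (K ∪ vset l)).card := by
          have := Finset.card_sdiff_add_card_inter e (K ∪ vset l)
          omega
        obtain ⟨w1, hw1, w2, hw2, hne⟩ := Finset.one_lt_card.1 h2
        have hw : ∃ w w' f, w ∈ e \ (K ∪ vset l) ∧ w' ∈ e ∧ f ∈ E ∧ w ∈ f ∧ w' ∉ f := by
          obtain ⟨f, hf, hff⟩ := hT w1 w2 hne e heE (Finset.mem_sdiff.1 hw1).1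
          by_cases hwf : w1 ∈ f
          · exact ⟨w1, w2, f, hw1, (Finset.mem_sdiff.1 hw2).1, hf, hwf, by tauto⟩
          · exact ⟨w2, w1, f, hw2, (Finset.mem_sdiff.1 hw1).1, hf, by tauto, hwf⟩
        obtain ⟨w, w', f, hwe, hw'e, hfE, hwf, hw'f⟩ := hw
        rw [Finset.mem_sdiff, Finset.mem_union, not_or] at hwe
        have hfl : f ∉ e :: l := by
          rw [List.mem_cons]
          rintro (rfl | hm)
          · exact hw'f hw'e
          · exact hwe.2.2 (subset_vset hm hwf)
        have hle : (f ∩ (K ∪ vset (e :: l))).card ≤ 1 := by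
          by_contra hcon
          exact hno (e :: l) f ⟨hl, by simp, hlE, hfE, hfl, fun h => hwe.2.1 (h hwf), by omega⟩
        rw [Finset.card_le_one] at hle
        have hall : ∀ y ∈ f, y ∈ K ∪ vset (e :: l) → y = w := by
          intro y hy hy2
          refine hle y (Finset.mem_inter.2 ⟨hy, hy2⟩) w (Finset.mem_inter.2 ⟨hwf, ?_⟩)
          rw [vset_cons]; simp [hwe.1]
        rw [vset_cons] at hall
        refine ⟨f :: e :: l, ⟨?_, ?_, hl⟩, by simp at hlen ⊢; omega, ?_⟩
        · rw [Finset.card_eq_one]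
          refine ⟨w, ?_⟩
          ext y
          simp only [Finset.mem_inter, Finset.mem_singleton]
          constructor
          · rintro ⟨hy, hy2⟩; exact hall y hy (by simp [hy2])
          · rintro rfl; exact ⟨hwf, hwe.1⟩
        · rw [Finset.eq_empty_iff_forall_notMem]
          intro y hy
          rw [Finset.mem_inter, Finset.mem_union] at hy
          have := hall y hy.1 (by simp only [Finset.mem_union]; tauto)
          subst this
          tauto
        · intro c hc
          rw [List.mem_cons] at hc
          rcases hc with rfl | hc
          · exact hfE
          · exact hlE c hc
  obtain ⟨l, hl, hlen, hlE⟩ := hext E.card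
  have hp := hl.lp.loosePath hk (by rintro rfl; simp at hlen) (fun c hc => hu c (hlE c hc))
  have hcard := List.toFinset_card_of_nodup hp.2.1
  have : l.toFinset ⊆ E := fun c hc => hlE c (List.mem_toFinset.1 hc)
  have := Finset.card_le_card this
  omega

theorem path_lemma {k : ℕ} (hk : 3 ≤ k) {E : Finset (Finset V)} (hu : Uniform k E)
    (hT : ∀ a b : V, a ≠ b → ∀ e0 ∈ E, a ∈ e0 → ∃ e ∈ E, ¬ (a ∈ e ↔ b ∈ e))
    {K e1 : Finset V} (hK : ∀ e ∈ E, e ⊆ K ∨ (e ∩ K).card ≤ 1)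
    (he1 : e1 ∈ E) (h1 : (e1 ∩ K).card = 1) :
    (∃ l P, RP K e1 l ∧ (∀ c ∈ l, c ∈ E) ∧ OPorLC k P ∧ (∀ c ∈ P, c ∈ E) ∧
      (vset P ∩ (K ∪ vset l)).card = 1) ∨
    ContainsBicycle k E ∨
    (∃ l e f z, RP K e1 (e :: l) ∧ (∀ c ∈ e :: l, c ∈ E) ∧ f ∈ E ∧ (f ∩ e).card = 1 ∧
      f ∩ vset l = ∅ ∧ f ∩ K = {z} ∧ z ∉ vset (e :: l)) ∨
    (∃ f z, f ∈ E ∧ f ≠ e1 ∧ 2 ≤ (f ∩ e1).card ∧ f ∩ K = {z} ∧ z ∉ e1) := by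
  classical
  have hex : ∃ n, ∃ l f, Failing E K e1 l f ∧ l.length = n := by
    obtain ⟨l, f, h⟩ := exists_failing hk hu hT he1 h1
    exact ⟨_, l, f, h, rfl⟩
  obtain ⟨l, f, ⟨hl, hl0, hlE, hfE, hfl, hfK, hf2⟩, hlen⟩ := Nat.find_spec hex
  have hmin : ∀ l' f', Failing E K e1 l' f' → l.length ≤ l'.length := by
    intro l' f' h'
    rw [hlen]
    exact Nat.find_min' hex ⟨l', f', h', rfl⟩
  clear hlen
  cases l with
  | nil => exact absurd rfl hl0
  | cons e l =>
  have hfe : f ≠ e := by rintro rfl; simp at hfl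
  have hfl' : f ∉ l := by intro h; simp [h] at hfl
  have heE := hlE e (by simp)
  have hlE' : ∀ c ∈ l, c ∈ E := fun c hc => hlE c (by simp [hc])
  have hU1 : (f ∩ (K ∪ vset l)).card ≤ 1 := by
    by_contra hcon
    by_cases hl0 : l = []
    · subst hl0
      rw [vset_nil, Finset.union_empty] at hcon
      rcases hK f hfE with h | h
      · exact hfK h
      · exact hcon h
    · have := hmin l f ⟨hl.tail, hl0, hlE', hfE, hfl', hfK, by omega⟩
      simp at this
  obtain ⟨v, hv, hve, hvU⟩ := card_one_mem (hl.head_card h1)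
  have hun : K ∪ vset (e :: l) = e ∪ (K ∪ vset l) := by
    rw [vset_cons]; ext; simp only [Finset.mem_union]; tauto
  rw [hun] at hf2
  rw [Finset.card_le_one] at hU1
  have hvE : ∀ y ∈ e, y ∈ K ∪ vset l → y = v := by
    intro y h1 h2
    have : y ∈ e ∩ (K ∪ vset l) := Finset.mem_inter.2 ⟨h1, h2⟩
    rw [hv] at this; simpa using this
  have hvs2 : vset [e, f] = e ∪ f := by simp [vset]
  by_cases hcase : 2 ≤ (f ∩ e).card
  · have hOP : OPorLC k [e, f] :=
      Or.inl (overlap_mk hfe.symm (hu e heE) (hu f hfE) (by rwa [Finset.inter_comm]))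
    have hOPE : ∀ c ∈ [e, f], c ∈ E := by simp [heE, hfE]
    by_cases hA : f ∩ (K ∪ vset l) ⊆ e
    · left
      refine ⟨l, [e, f], hl.tail, hlE', hOP, hOPE, ?_⟩
      rw [hvs2, Finset.card_eq_one]
      refine ⟨v, ?_⟩
      rw [Finset.union_inter_distrib_right, hv, Finset.union_eq_left, ← hv]
      exact Finset.subset_inter hA Finset.inter_subset_right
    · rw [Finset.not_subset] at hA
      obtain ⟨z, hz, hze⟩ := hA
      have hzz : ∀ y ∈ f, y ∈ K ∪ vset l → y = z := fun y h1 h2 =>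
        hU1 y (Finset.mem_inter.2 ⟨h1, h2⟩) z hz
      rw [Finset.mem_inter] at hz
      cases l with
      | nil =>
        have hee : e = e1 := hl
        subst hee
        right; right; right
        refine ⟨f, z, hfE, hfe, hcase, ?_, hze⟩
        rw [vset_nil, Finset.union_empty] at *
        ext y
        simp only [Finset.mem_inter, Finset.mem_singleton]
        exact ⟨fun h => hzz y h.1 h.2, fun h => h ▸ hz⟩
      | cons e' l =>
        obtain ⟨h3, h4, h5⟩ := hl
        have hun' : K ∪ vset (e' :: l) = e' ∪ (K ∪ vset l) := by
          rw [vset_cons]; ext; simp only [Finset.mem_union]; tauto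
        rw [hun'] at hz hvU
        simp only [hun'] at hzz hvE
        have he'E := hlE' e' (by simp)
        by_cases hze' : z ∈ e'
        · right; left
          have hve' : v ∈ e' := by
            rw [Finset.mem_union] at hvU
            rcases hvU with h | h
            · exact h
            · have : v ∈ e ∩ (K ∪ vset l) := Finset.mem_inter.2 ⟨hve, h⟩
              rw [h4] at this; simp at this
          refine bicycle_handle hk hu hOP hOPE he'E ?_ ?_
          · rw [hvs2]
            change 1 < _
            rw [Finset.one_lt_card]
            exact ⟨v, by simp [hve, hve'], z, by simp [hz.1, hze'], by rintro rfl; exact hze hve⟩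
          · rw [hvs2]
            intro hsub
            have : e' ⊆ {v, z} := by
              intro y hy
              have hyU : y ∈ e' ∪ (K ∪ vset l) := Finset.mem_union_left _ hy
              have := hsub hy
              rw [Finset.mem_union] at this
              rcases this with h | h
              · simp [hvE y h hyU]
              · simp [hzz y h hyU]
            have h6 := Finset.card_le_card this
            have h7 := Finset.card_le_two (a := v) (b := z)
            rw [hu e' he'E] at h6
            omega
        · left
          have hz2 : z ∈ K ∪ vset l := (Finset.mem_union.1 hz.2).resolve_left hze'
          refine ⟨l, [e, f], h5.tail, fun c hc => hlE' c (by simp [hc]), hOP, hOPE, ?_⟩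
          rw [hvs2, Finset.card_eq_one]
          refine ⟨z, ?_⟩
          rw [Finset.union_inter_distrib_right, h4, Finset.empty_union]
          ext y
          simp only [Finset.mem_inter, Finset.mem_singleton]
          exact ⟨fun h => hzz y h.1 (Finset.mem_union_right _ h.2), fun h => h ▸ ⟨hz.1, hz2⟩⟩
  · rw [Finset.inter_union_distrib_left] at hf2
    have hU1' : (f ∩ (K ∪ vset l)).card ≤ 1 := Finset.card_le_one.2 hU1
    have hcu := Finset.card_union_le (f ∩ e) (f ∩ (K ∪ vset l))
    have hfe1 : (f ∩ e).card = 1 := by omega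
    have hz : ∃ z ∈ f ∩ (K ∪ vset l), z ∉ e := by
      by_contra hcon
      push Not at hcon
      have : f ∩ (K ∪ vset l) ⊆ f ∩ e := fun y hy =>
        Finset.mem_inter.2 ⟨(Finset.mem_inter.1 hy).1, hcon y hy⟩
      rw [Finset.union_eq_left.2 this] at hf2
      omega
    obtain ⟨z, hz, hze⟩ := hz
    have hzz : ∀ y ∈ f, y ∈ K ∪ vset l → y = z := fun y h1 h2 =>
      hU1 y (Finset.mem_inter.2 ⟨h1, h2⟩) z hz
    rw [Finset.mem_inter] at hz
    by_cases hzl : z ∈ vset l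
    · left
      obtain ⟨s, a, t, rfl, hza, hzs⟩ := exists_first hzl
      have haE := hlE' a (by simp)
      have hvl : vset (s ++ a :: t) = vset s ∪ (a ∪ vset t) := by rw [vset_append, vset_cons]
      have hLC : LooseCycle (f :: e :: (s ++ [a])) := by
        apply looseCycle_of_path hk
        · apply LP.prefix (l₂ := t)
          have := hl.lp
          simpa using this
        · intro c hc
          apply hu
          apply hlE
          simp at hc ⊢
          tauto
        · exact hu f hfE
        · exact hfe1
        · rw [Finset.card_eq_one]
          refine ⟨z, ?_⟩
          ext y
          simp only [Finset.mem_inter, Finset.mem_singleton]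
          refine ⟨fun h => hzz y h.1 ?_, fun h => h ▸ ⟨hz.1, hza⟩⟩
          rw [hvl]; simp only [Finset.mem_union]; tauto
        · rw [Finset.eq_empty_iff_forall_notMem]
          intro y hy
          rw [Finset.mem_inter] at hy
          have := hzz y hy.1 (by rw [hvl]; simp only [Finset.mem_union]; tauto)
          subst this
          exact hzs hy.2
      have hsuf : RP K e1 (a :: t) := hl.tail.suffix s
      refine ⟨t, f :: e :: (s ++ [a]), hsuf.tail, fun c hc => hlE' c (by simp [hc]), Or.inr hLC, ?_, ?_⟩
      · intro c hc
        simp only [List.mem_cons, List.mem_append, List.not_mem_nil, or_false] at hc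
        rcases hc with rfl | rfl | hc | rfl
        · exact hfE
        · exact heE
        · exact hlE' c (by simp [hc])
        · exact haE
      · have hd : vset (e :: s) ∩ (K ∪ vset t) = ∅ := RP.disj (a := a) (by simpa using hl)
        have hh := hsuf.head_card h1
        have : vset (f :: e :: (s ++ [a])) ∩ (K ∪ vset t) = a ∩ (K ∪ vset t) := by
          have e1 : vset (f :: e :: (s ++ [a])) = f ∪ (vset (e :: s) ∪ a) := by
            simp only [vset_cons, vset_append, vset_nil, Finset.union_empty, Finset.union_assoc]
          rw [e1, Finset.union_inter_distrib_right, Finset.union_inter_distrib_right, hd,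
            Finset.empty_union, Finset.union_eq_right]
          intro y hy
          rw [Finset.mem_inter] at hy ⊢
          refine ⟨?_, hy.2⟩
          have := hzz y hy.1 (by
            rw [hvl]
            have := hy.2
            simp only [Finset.mem_union] at this ⊢; tauto)
          rw [this]; exact hza
        rw [this, hh]
    · right; right; left
      have hzK : z ∈ K := (Finset.mem_union.1 hz.2).resolve_right hzl
      refine ⟨l, e, f, z, hl, hlE, hfE, hfe1, ?_, ?_, ?_⟩
      · rw [Finset.eq_empty_iff_forall_notMem]
        intro y hy
        rw [Finset.mem_inter] at hy
        have := hzz y hy.1 (Finset.mem_union_right _ hy.2)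
        subst this
        exact hzl hy.2
      · ext y
        simp only [Finset.mem_inter, Finset.mem_singleton]
        exact ⟨fun h => hzz y h.1 (Finset.mem_union_left _ h.2), fun h => h ▸ ⟨hz.1, hzK⟩⟩
      · rw [vset_cons, Finset.mem_union]; tauto


theorem mem_of_inter_eq {A B : Finset V} {x : V} (h : A ∩ B = {x}) : x ∈ A ∧ x ∈ B := by
  have : x ∈ A ∩ B := by rw [h]; simp
  exact Finset.mem_inter.1 this

theorem eq_of_inter_eq {A B : Finset V} {x y : V} (h : A ∩ B = {x}) (hA : y ∈ A) (hB : y ∈ B) :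
    y = x := by
  have : y ∈ A ∩ B := Finset.mem_inter.2 ⟨hA, hB⟩
  rw [h] at this
  simpa using this

theorem not_mem_of_inter_empty {A B : Finset V} {y : V} (h : A ∩ B = ∅) (hA : y ∈ A) : y ∉ B := by
  intro hB
  have : y ∈ A ∩ B := Finset.mem_inter.2 ⟨hA, hB⟩
  rw [h] at this
  simp at this

theorem bicycle_B {k : ℕ} (hk : 3 ≤ k) {E : Finset (Finset V)} (hu : Uniform k E)
    (hT : ∀ a b : V, a ≠ b → ∀ e0 ∈ E, a ∈ e0 → ∃ e ∈ E, ¬ (a ∈ e ↔ b ∈ e))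
    {C : List (Finset V)} (hC : OPorLC k C) (hCE : ∀ c ∈ C, c ∈ E) {e1 : Finset V} {x : V}
    (he1 : e1 ∈ E) (hx : e1 ∩ vset C = {x})
    (hK : ∀ e ∈ E, e ⊆ vset C ∨ (e ∩ vset C).card ≤ 1)
    (htype : (∀ y ∈ vset C, ∃ c ∈ E, ∃ c' ∈ E, c ≠ c' ∧ 2 ≤ (c ∩ c').card ∧ c ⊆ vset C ∧
        c' ⊆ vset C ∧ x ∈ c ∧ y ∈ c) ∨
      (LooseCycle C ∧ ∀ a ∈ E, ∀ b ∈ E, a ≠ b → (a ∩ b).card ≤ 1)) :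
    ContainsBicycle k E := by
  have h1 : (e1 ∩ vset C).card = 1 := by rw [hx]; simp
  obtain ⟨hxe1, hxK⟩ := mem_of_inter_eq hx
  rcases path_lemma hk hu hT hK he1 h1 with ⟨l, P, hl, hlE, hP, hPE, hPU⟩ | hb |
    ⟨l, e, f, z, hl, hlE, hfE, hfe, hfl, hfK, hz⟩ | ⟨f, z, hfE, hfe, hf2, hfK, hz⟩
  · exact bicycle_hang hk hu hC hCE h1 hl hlE hP hPE hPU
  · exact hb
  · obtain ⟨hzf, hzK⟩ := mem_of_inter_eq hfK
    obtain ⟨m, hm, hmK⟩ := hl.last (by simp)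
    have hlp : LP (f :: e :: l) := ⟨hfe, hfl, hl.lp⟩
    have hE' : ∀ c ∈ f :: e :: l, c ∈ E := by
      intro c hc
      rw [List.mem_cons] at hc
      rcases hc with rfl | hc
      · exact hfE
      · exact hlE c hc
    have hxv : x ∈ vset (e :: l) := subset_vset (by rw [hm]; simp) hxe1
    have hxz : x ≠ z := by rintro rfl; exact hz hxv
    have hKl : vset C ∩ vset (e :: l) = {x} := by
      rw [hl.inter_K (by simp), Finset.inter_comm, hx]
    rcases htype with ht | ⟨hLC, hlin⟩
    · obtain ⟨c, hc, c', hc', hne, hc2, hcK, hc'K, hxc, hzc⟩ := ht z hzK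
      have hcy : LooseCycle (c :: f :: (m ++ [e1])) := by
        rw [hm] at hlp hE'
        refine looseCycle_of_path hk hlp (fun a ha => hu a (hE' a ha)) (hu c hc) ?_ ?_ ?_
        · rw [Finset.card_eq_one]
          refine ⟨z, ?_⟩
          ext y
          simp only [Finset.mem_inter, Finset.mem_singleton]
          exact ⟨fun h => eq_of_inter_eq hfK h.2 (hcK h.1), fun h => h ▸ ⟨hzc, hzf⟩⟩
        · rw [Finset.card_eq_one]
          refine ⟨x, ?_⟩
          ext y
          simp only [Finset.mem_inter, Finset.mem_singleton]
          exact ⟨fun h => eq_of_inter_eq hx h.2 (hcK h.1), fun h => h ▸ ⟨hxc, hxe1⟩⟩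
        · rw [Finset.eq_empty_iff_forall_notMem]
          intro y hy
          rw [Finset.mem_inter] at hy
          exact not_mem_of_inter_empty hmK hy.2 (hcK hy.1)
      rw [← hm] at hcy
      have hvs : vset (c :: f :: e :: l) = c ∪ (f ∪ vset (e :: l)) := by
        rw [vset_cons, vset_cons]
      refine bicycle_handle hk hu (Or.inr hcy) ?_ hc' ?_ ?_
      · intro a ha
        rw [List.mem_cons] at ha
        rcases ha with rfl | ha
        · exact hc
        · exact hE' a ha
      · refine hc2.trans (Finset.card_le_card ?_)
        rw [hvs, Finset.inter_comm]
        exact Finset.inter_subset_inter_left Finset.subset_union_left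
      · intro hsub
        have : c' ⊆ c := by
          intro y hy
          have h2 := hsub hy
          rw [hvs, Finset.mem_union, Finset.mem_union] at h2
          rcases h2 with h2 | h2 | h2
          · exact h2
          · rw [eq_of_inter_eq hfK h2 (hc'K hy)]; exact hzc
          · rw [eq_of_inter_eq hKl (hc'K hy) h2]; exact hxc
        exact hne (Finset.eq_of_subset_of_card_le this (by rw [hu c hc, hu c' hc'])).symm
    · obtain ⟨L, c, hL, hxc, hp⟩ := hLC.end_at hxK
      obtain ⟨val1, ch1⟩ := hL.valid hk
      have hpE := perm_mem_of hp hCE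
      have hvp := vset_perm hp
      have hR1 : (e :: l).reverse = e1 :: m.reverse := by rw [hm]; simp
      have hR2 : (e :: l).reverse = l.reverse ++ [e] := by simp
      have hRE : ∀ c ∈ (e :: l).reverse, c ∈ E := fun c hc => hlE c (List.mem_reverse.1 hc)
      have hLP : LoosePath (e :: l).reverse :=
        hl.lp.reverse.loosePath hk (by simp) (fun c hc => hu c (hRE c hc))
      have hLP2 : LoosePath ((e :: l).reverse ++ [f]) := by
        have := hlp.reverse.loosePath hk (by simp) (fun c hc => hu c (hE' c (List.mem_reverse.1 hc)))
        rwa [List.reverse_cons] at this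
      obtain ⟨valR, chR⟩ := hLP.valid hk
      have hcap1 : vset (L ++ [c]) ∩ vset (e :: l).reverse = {x} := by
        rw [vset_reverse, hvp, hKl]
      have valA : Valid k (L ++ [c] ++ (e :: l).reverse) := by
        rw [hR1] at valR hRE hcap1 ⊢
        exact valid_append hk val1 (by simp) valR (fun e he => hu e (hRE e he)) hcap1 hxe1
      have chA : Chain (L ++ [c] ++ (e :: l).reverse) := by
        rw [hR1] at chR ⊢
        exact chain_append ch1 chR hxc hxe1
      obtain ⟨w, hw, hwf, hwe⟩ := card_one_mem hfe
      have hfv : f ∩ vset (L ++ [c] ++ (e :: l).reverse) = {z} ∪ {w} := by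
        rw [vset_append, vset_reverse, hvp, Finset.inter_union_distrib_left, hfK, vset_cons,
          Finset.inter_union_distrib_left, hfl, hw, Finset.union_empty]
      have hfv2 : (f ∩ vset (L ++ [c] ++ (e :: l).reverse)).card ≤ 2 := by
        rw [hfv]; exact Finset.card_le_two
      have hfv1 : 1 ≤ (f ∩ vset (L ++ [c] ++ (e :: l).reverse)).card := by
        rw [hfv]; exact Finset.card_pos.2 ⟨z, by simp⟩
      refine ⟨L ++ [c] ++ ((e :: l).reverse ++ [f]), ?_, Or.inr (Or.inr (Or.inl
        ⟨?_, ?_, L ++ [c], (e :: l).reverse ++ [f], rfl, hL, hLP2, by simp, x, z, hxz, ?_, ?_, ?_⟩))⟩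
      · intro a ha
        rw [List.mem_toFinset, ← List.append_assoc, List.mem_append, List.mem_append] at ha
        rcases ha with (ha | ha) | ha
        · exact hpE a ha
        · exact hRE a ha
        · simp at ha; exact ha ▸ hfE
      · rw [← List.append_assoc, valid_snoc (by simp)]
        refine ⟨valA, ?_, hfv1, by omega⟩
        intro hm
        have := subset_vset hm
        rw [Finset.inter_eq_left.2 this, hu f hfE] at hfv2
        omega
      · rw [← List.append_assoc]
        rw [hR2, ← List.append_assoc] at chA ⊢
        exact chain_append chA (chain_iff.2 (by simp)) hwe hwf
      · rw [vset_append _ [f], Finset.inter_union_distrib_left, hcap1, vset_singleton, hvp,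
          Finset.inter_comm, hfK]
        rfl
      · have hlast : (L ++ [c]).getD ((L ++ [c]).length - 1) ∅ = c := by
          have : (L ++ [c]).length - 1 = L.length := by simp
          rw [this, getD_snoc_eq]
        have hcK : c ⊆ vset C := by rw [← hvp]; exact subset_vset (by simp)
        rw [hlast, hR1]
        have hx1 : x ∉ (e1 :: m.reverse ++ [f]).getD 1 ∅ := by
          rw [List.cons_append, List.getD_cons_succ]
          have : (m.reverse ++ [f]).getD 0 ∅ ∈ m.reverse ++ [f] := getD_mem (by simp)
          rw [List.mem_append, List.mem_reverse, List.mem_singleton] at this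
          intro hxm
          rcases this with h | h
          · exact not_mem_of_inter_empty hmK (subset_vset h hxm) hxK
          · rw [h] at hxm
            exact hxz (eq_of_inter_eq hfK hxm hxK)
        ext y
        rw [Finset.mem_inter, Finset.mem_sdiff, Finset.mem_singleton]
        constructor
        · rintro ⟨⟨h1, -⟩, h2⟩
          exact eq_of_inter_eq hx h1 (hcK h2)
        · rintro rfl
          exact ⟨⟨hxe1, hx1⟩, hxc⟩
      · have hzK' := hzK
        rw [← hvp, mem_vset] at hzK'
        obtain ⟨d, hd, hzd⟩ := hzK'
        have hdK : d ⊆ vset C := by rw [← hvp]; exact subset_vset hd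
        obtain ⟨a, ha, rfl⟩ := exists_getD hd
        refine ⟨a, ha, ?_⟩
        have e1 : ((e :: l).reverse ++ [f]).length - 1 = (e :: l).reverse.length := by simp
        have e2 : ((e :: l).reverse ++ [f]).length - 2 = l.reverse.length := by simp
        rw [e1, e2, getD_snoc_eq, hR2, List.append_assoc, List.getD_append_right _ _ _ _ le_rfl]
        simp only [Nat.sub_self, List.cons_append, List.getD_cons_zero]
        ext y
        rw [Finset.mem_inter, Finset.mem_sdiff, Finset.mem_singleton]
        constructor
        · rintro ⟨⟨h1, -⟩, h2⟩
          exact eq_of_inter_eq hfK h1 (hdK h2)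
        · rintro rfl
          exact ⟨⟨hzf, fun h => hz (subset_vset (by simp) h)⟩, hzd⟩
  · obtain ⟨hzf, hzK⟩ := mem_of_inter_eq hfK
    rcases htype with ht | ⟨hLC, hlin⟩
    · obtain ⟨c, hc, c', hc', hne, hc2, hcK, hc'K, hxc, hzc⟩ := ht z hzK
      have hvs : vset [f, e1] = f ∪ e1 := by simp [vset]
      refine bicycle_handle hk hu (C := [f, e1])
        (Or.inl (overlap_mk hfe (hu f hfE) (hu e1 he1) hf2)) ?_ hc ?_ ?_
      · simp [hfE, he1]
      · rw [hvs]
        change 1 < _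
        rw [Finset.one_lt_card]
        exact ⟨x, by simp [hxc, hxe1], z, by simp [hzc, hzf], by rintro rfl; exact hz hxe1⟩
      · rw [hvs]
        intro hsub
        have : c ⊆ {z, x} := by
          intro y hy
          have := hsub hy
          rw [Finset.mem_union] at this
          rcases this with h | h
          · simp [eq_of_inter_eq hfK h (hcK hy)]
          · simp [eq_of_inter_eq hx h (hcK hy)]
        have h6 := Finset.card_le_card this
        have h7 := Finset.card_le_two (a := z) (b := x)
        rw [hu c hc] at h6
        omega
    · have := hlin f hfE e1 he1 hfe
      omega


theorem near_of_no_bicycle {k : ℕ} (hk : 3 ≤ k) {E : Finset (Finset V)} (hu : Uniform k E)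
    (hnob : ¬ ContainsBicycle k E) {C : List (Finset V)} (hC : OPorLC k C) (hCE : ∀ c ∈ C, c ∈ E) :
    ∀ e ∈ E, e ⊆ vset C ∨ (e ∩ vset C).card ≤ 1 := by
  intro e he
  by_contra hcon
  rw [not_or] at hcon
  exact hnob (bicycle_handle hk hu hC hCE he (by omega) hcon.1)

theorem exists_exit {E : Finset (Finset V)}
    (hconn : ∀ W : Finset V, (∃ e ∈ E, e ⊆ W) → (∀ e ∈ E, e ⊆ W ∨ e ∩ W = ∅) → ∀ e ∈ E, e ⊆ W)
    {K : Finset V} (hK : ∀ e ∈ E, e ⊆ K ∨ (e ∩ K).card ≤ 1) (h0 : ∃ e ∈ E, e ⊆ K)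
    (h1 : ¬ ∀ e ∈ E, e ⊆ K) : ∃ e1 ∈ E, ∃ x, e1 ∩ K = {x} := by
  by_contra hcon
  push Not at hcon
  apply h1
  apply hconn K h0
  intro e he
  rcases hK e he with h | h
  · exact Or.inl h
  · right
    by_contra hne
    have : (e ∩ K).card = 1 := by
      have := Finset.card_pos.2 (Finset.nonempty_iff_ne_empty.2 hne)
      omega
    obtain ⟨x, hx⟩ := Finset.card_eq_one.1 this
    exact hcon e he x hx

theorem op_stage {k : ℕ} (hk : 3 ≤ k) {X : Finset V} {E : Finset (Finset V)}
    (hEX : ∀ e ∈ E, e ⊆ X) (hu : Uniform k E) (hnob : ¬ ContainsBicycle k E)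
    (hT : ∀ a b : V, a ≠ b → ∀ e0 ∈ E, a ∈ e0 → ∃ e ∈ E, ¬ (a ∈ e ↔ b ∈ e))
    (hconn : ∀ W : Finset V, (∃ e ∈ E, e ⊆ W) → (∀ e ∈ E, e ⊆ W ∨ e ∩ W = ∅) → ∀ e ∈ E, e ⊆ W)
    {c1 c2 : Finset V} (hc1 : c1 ∈ E) (hc2 : c2 ∈ E) (hne : c1 ≠ c2) (h2 : 2 ≤ (c1 ∩ c2).card) :
    BreakerWins (fun M => ∃ e ∈ E, e ⊆ M) X := by
  have hC : OPorLC k [c1, c2] := Or.inl (overlap_mk hne (hu c1 hc1) (hu c2 hc2) h2)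
  have hCE : ∀ c ∈ [c1, c2], c ∈ E := by simp [hc1, hc2]
  have hvs : ∀ a b : Finset V, vset [a, b] = a ∪ b := by intro a b; simp [vset]
  have hK := near_of_no_bicycle hk hu hnob hC hCE
  rw [hvs] at hK
  have hk1 := hu c1 hc1
  have hk2 := hu c2 hc2
  have hs1 : c1 ⊆ c1 ∪ c2 := Finset.subset_union_left
  have hs2 : c2 ⊆ c1 ∪ c2 := Finset.subset_union_right
  have hcardW := Finset.card_union_add_card_inter c1 c2
  by_cases hg : ∃ g ∈ E, g ≠ c1 ∧ g ≠ c2 ∧ g ⊆ c1 ∪ c2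
  · obtain ⟨g, hgE, hg1, hg2, hgW⟩ := hg
    have Q0 : ∀ a ∈ E, ∀ b ∈ E, a ⊆ c1 ∪ c2 → b ⊆ c1 ∪ c2 → 2 ≤ (a ∩ b).card := by
      intro a ha b hb haW hbW
      have h3 := Finset.card_union_add_card_inter a b
      have h4 := Finset.card_le_card (Finset.union_subset haW hbW)
      rw [hu a ha, hu b hb] at h3
      omega
    have Q1 : ∀ a ∈ E, ∀ b ∈ E, ∀ c ∈ E, a ⊆ c1 ∪ c2 → b ⊆ c1 ∪ c2 → c ⊆ c1 ∪ c2 → a ≠ c →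
        ∀ y ∈ b, y ∉ a → y ∈ c := by
      intro a ha b hb c hc haW hbW hcW hac y hyb hya
      have hn := near_of_no_bicycle hk hu hnob (C := [a, c])
        (Or.inl (overlap_mk hac (hu a ha) (hu c hc) (Q0 a ha c hc haW hcW))) (by simp [ha, hc]) b hb
      rw [hvs] at hn
      rcases hn with hn | hn
      · exact (Finset.mem_union.1 (hn hyb)).resolve_left hya
      · have h3 := Q0 b hb a ha hbW haW
        have h4 : b ∩ a ⊆ b ∩ (a ∪ c) := Finset.inter_subset_inter_left Finset.subset_union_left
        have := Finset.card_le_card h4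
        omega
    have hall : ∀ e ∈ E, e ⊆ c1 ∪ c2 := by
      by_contra hcon
      obtain ⟨e1, he1, x, hx⟩ := exists_exit hconn hK ⟨c1, hc1, hs1⟩ hcon
      have hxW := (mem_of_inter_eq hx).2
      refine hnob (bicycle_B hk hu hT hC hCE he1 (x := x) (by rw [hvs]; exact hx)
        (by rw [hvs]; exact hK) (Or.inl ?_))
      rw [hvs]
      intro y hy
      by_cases hA : x ∈ c1 ∧ y ∈ c1
      · exact ⟨c1, hc1, c2, hc2, hne, h2, hs1, hs2, hA⟩
      by_cases hB : x ∈ c2 ∧ y ∈ c2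
      · exact ⟨c2, hc2, c1, hc1, hne.symm, by rwa [Finset.inter_comm], hs2, hs1, hB⟩
      refine ⟨g, hgE, c1, hc1, hg1, Q0 g hgE c1 hc1 hgW hs1, hgW, hs1, ?_⟩
      rw [Finset.mem_union] at hxW hy
      have t1 := Q1 c1 hc1 c2 hc2 g hgE hs1 hs2 hgW hg1.symm
      have t2 := Q1 c2 hc2 c1 hc1 g hgE hs2 hs1 hgW hg2.symm
      by_cases hx1 : x ∈ c1
      · have hy1 : y ∉ c1 := fun h => hA ⟨hx1, h⟩
        have hy2 : y ∈ c2 := by tauto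
        have hx2 : x ∉ c2 := fun h => hB ⟨h, hy2⟩
        exact ⟨t2 x hx1 hx2, t1 y hy2 hy1⟩
      · have hx2 : x ∈ c2 := by tauto
        have hy2 : y ∉ c2 := fun h => hB ⟨hx2, h⟩
        exact ⟨t1 x hx2 hx1, t2 y (by tauto) hy2⟩
    have hA : (c1 \ c2).card ≤ 1 := by
      by_contra hcon
      push Not at hcon
      obtain ⟨a, ha, b, hb, hab⟩ := Finset.one_lt_card.1 hcon
      rw [Finset.mem_sdiff] at ha hb
      obtain ⟨e, he, hs⟩ := hT a b hab c1 hc1 ha.1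
      apply hs
      by_cases h3 : e = c2
      · subst h3; tauto
      · have t2 := Q1 c2 hc2 c1 hc1 e he hs2 hs1 (hall e he) (Ne.symm h3)
        exact ⟨fun _ => t2 b hb.1 hb.2, fun _ => t2 a ha.1 ha.2⟩
    have hsd := Finset.card_sdiff_add_card_inter c1 c2
    have hin : (c1 ∩ c2).card ≤ k - 1 := by
      refine inter_card_le hk1 (fun h => hne ?_)
      exact Finset.eq_of_subset_of_card_le h (by omega)
    obtain ⟨D1, hD1, hD1c⟩ := Finset.exists_subset_card_eq (s := c1 ∪ c2) (n := 2) (by omega)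
    have h3 : 2 ≤ ((c1 ∪ c2) \ D1).card := by
      rw [Finset.card_sdiff_of_subset hD1]; omega
    obtain ⟨D2, hD2, hD2c⟩ := Finset.exists_subset_card_eq h3
    have hD2W : D2 ⊆ c1 ∪ c2 := hD2.trans Finset.sdiff_subset
    have hdis : Disjoint D1 D2 := by
      rw [Finset.disjoint_left]
      intro y hy hy2
      exact (Finset.mem_sdiff.1 (hD2 hy2)).2 hy
    have hWX : c1 ∪ c2 ⊆ X := Finset.union_subset (hEX c1 hc1) (hEX c2 hc2)
    refine breaker_pairing (D := {D1, D2}) ?_ ?_ ?_ ?_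
    · intro d hd
      simp only [Finset.mem_insert, Finset.mem_singleton] at hd
      rcases hd with rfl | rfl
      · exact hD1.trans hWX
      · exact hD2W.trans hWX
    · intro d hd
      simp only [Finset.mem_insert, Finset.mem_singleton] at hd
      rcases hd with rfl | rfl <;> omega
    · intro d hd d' hd' hdd
      simp only [Finset.mem_insert, Finset.mem_singleton] at hd hd'
      rcases hd with rfl | rfl <;> rcases hd' with rfl | rfl
      · exact absurd rfl hdd
      · exact hdis
      · exact hdis.symm
      · exact absurd rfl hdd
    · intro e he
      by_cases hd1 : D1 ⊆ e
      · exact ⟨D1, by simp, hd1⟩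
      · refine ⟨D2, by simp, ?_⟩
        intro y hy
        by_contra hye
        obtain ⟨w, hw, hwe⟩ := Finset.not_subset.1 hd1
        have h5 : 1 < ((c1 ∪ c2) \ e).card := by
          rw [Finset.one_lt_card]
          refine ⟨w, Finset.mem_sdiff.2 ⟨hD1 hw, hwe⟩, y, Finset.mem_sdiff.2 ⟨hD2W hy, hye⟩, ?_⟩
          rintro rfl
          exact Finset.disjoint_left.1 hdis hw hy
        rw [Finset.card_sdiff_of_subset (hall e he), hu e he] at h5
        omega
  · exfalso
    push Not at hg
    obtain ⟨a, ha, b, hb, hab⟩ := Finset.one_lt_card.1 (show 1 < (c1 ∩ c2).card by omega)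
    rw [Finset.mem_inter] at ha hb
    obtain ⟨h, hhE, hsep⟩ := hT a b hab c1 hc1 ha.1
    have hh1 : h ≠ c1 := by rintro rfl; tauto
    have hh2 : h ≠ c2 := by rintro rfl; tauto
    have hhW := (hK h hhE).resolve_left (hg h hhE hh1 hh2)
    have hx : ∃ x, x ∈ h ∧ x ∈ c1 ∧ x ∈ c2 := by
      by_cases hah : a ∈ h
      · exact ⟨a, hah, ha⟩
      · exact ⟨b, by tauto, hb⟩
    obtain ⟨x, hxh, hx1, hx2⟩ := hx
    have hxx : h ∩ (c1 ∪ c2) = {x} := by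
      rw [Finset.card_le_one] at hhW
      have hxm : x ∈ h ∩ (c1 ∪ c2) := by simp [hxh, hx1]
      ext y
      rw [Finset.mem_singleton]
      exact ⟨fun hy => hhW y hy x hxm, fun hy => hy ▸ hxm⟩
    refine hnob (bicycle_B hk hu hT hC hCE hhE (x := x) (by rw [hvs]; exact hxx)
        (by rw [hvs]; exact hK) (Or.inl ?_))
    rw [hvs]
    intro y hy
    rw [Finset.mem_union] at hy
    rcases hy with hy | hy
    · exact ⟨c1, hc1, c2, hc2, hne, h2, hs1, hs2, hx1, hy⟩
    · exact ⟨c2, hc2, c1, hc1, hne.symm, by rwa [Finset.inter_comm], hs2, hs1, hx2, hy⟩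


theorem lp_of_index {l : List (Finset V)}
    (h : ∀ i j, i < j → j < l.length →
      (l.getD i ∅ ∩ l.getD j ∅).card = if j = i + 1 then 1 else 0) : LP l := by
  induction l with
  | nil => trivial
  | cons f l ih =>
    cases l with
    | nil => trivial
    | cons e l =>
      refine ⟨?_, ?_, ih ?_⟩
      · have := h 0 1 (by omega) (by simp)
        simpa using this
      · rw [Finset.eq_empty_iff_forall_notMem]
        intro y hy
        rw [Finset.mem_inter, mem_vset] at hy
        obtain ⟨hyf, d, hd, hyd⟩ := hy
        obtain ⟨i, hi, rfl⟩ := exists_getD hd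
        have := h 0 (i + 2) (by omega) (by simp; omega)
        rw [if_neg (by omega), Finset.card_eq_zero] at this
        simp only [List.getD_cons_succ, List.getD_cons_zero] at this
        exact not_mem_of_inter_empty this hyf hyd
      · intro i j hij hj
        have := h (i + 1) (j + 1) (by omega) (by simpa using hj)
        rw [List.getD_cons_succ, List.getD_cons_succ] at this
        rw [this]
        refine if_congr ?_ rfl rfl
        omega

theorem LooseCycle.lp_prefix {l t : List (Finset V)} (h : LooseCycle (l ++ t)) (ht : t ≠ []) :
    LP l := by
  apply lp_of_index
  have htl := List.length_pos_iff.2 ht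
  intro i j hij hj
  have := h.2.2 i j hij (by simp; omega)
  rw [List.getD_append _ _ _ _ hj, List.getD_append _ _ _ _ (by omega)] at this
  rw [this]
  refine if_congr ?_ rfl rfl
  simp only [List.length_append]
  omega

theorem triangle {a b c : Finset V} (hab : a ≠ b) (hbc : b ≠ c) (hac : a ≠ c)
    (h1 : (a ∩ b).card = 1) (h2 : (b ∩ c).card = 1) (h3 : (a ∩ c).card = 1) :
    LooseCycle [a, b, c] := by
  refine ⟨by simp, by simp [hab, hbc, hac], ?_⟩
  intro i j hij hj
  simp at hj
  have : (i = 0 ∧ j = 1) ∨ (i = 0 ∧ j = 2) ∨ (i = 1 ∧ j = 2) := by omega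
  rcases this with ⟨rfl, rfl⟩ | ⟨rfl, rfl⟩ | ⟨rfl, rfl⟩ <;> simpa

theorem no_chord {k : ℕ} (hk : 3 ≤ k) {E : Finset (Finset V)} (hu : Uniform k E)
    (hlin : ∀ a ∈ E, ∀ b ∈ E, a ≠ b → (a ∩ b).card ≤ 1)
    {C : List (Finset V)} (hC : LooseCycle C) (hCE : ∀ c ∈ C, c ∈ E)
    (hmin : ∀ C', LooseCycle C' → (∀ c ∈ C', c ∈ E) → C.length ≤ C'.length)
    (h4 : 4 ≤ C.length) {g : Finset V} (hgE : g ∈ E) (hgC : g ∉ C) (hgK : g ⊆ vset C) : False := by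
  have hgk := hu g hgE
  obtain ⟨p, hp⟩ := Finset.card_pos.1 (show 0 < g.card by omega)
  have hrot : ∃ c0 c1 R, LooseCycle (c0 :: c1 :: R) ∧ (c0 :: c1 :: R).Perm C ∧ p ∈ c0 ∧ p ∉ c1 := by
    obtain ⟨L, c, hL, hpc, hperm⟩ := hC.end_at (hgK hp)
    have hlen := hperm.length_eq
    have hL' := looseCycle_rot L hL
    have hperm' : ([c] ++ L).Perm C := List.perm_append_comm.trans hperm
    match L, hL', hperm', hlen with
    | [], _, _, hlen => simp at hlen; omega
    | [_], _, _, hlen => simp at hlen; omega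
    | c1 :: c2 :: R, hL', hperm', hlen =>
      by_cases hp1 : p ∈ c1
      · refine ⟨c1, c2, R ++ [c], ?_, ?_, hp1, ?_⟩
        · exact looseCycle_rot [c] hL'
        · refine List.Perm.trans ?_ hperm'
          exact List.perm_append_comm (l₁ := c1 :: c2 :: R) (l₂ := [c])
        · have := hL'.2.2 0 2 (by omega) (by simp)
          have hRl : 1 ≤ R.length := by simp at hlen; omega
          have hcond : ¬ (2 = 0 + 1 ∨ (0 = 0 ∧ 2 = ([c] ++ c1 :: c2 :: R).length - 1)) := by
            simp only [List.length_append, List.length_cons, List.length_nil]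
            omega
          rw [if_neg hcond, Finset.card_eq_zero] at this
          exact not_mem_of_inter_empty this hpc
      · exact ⟨c, c1, c2 :: R, hL', hperm', hpc, hp1⟩
  obtain ⟨c0, c1, R, hCy, hperm, hp0, hp1⟩ := hrot
  have hCE' := perm_mem_of hperm hCE
  have hgC' : ∀ c ∈ c0 :: c1 :: R, g ≠ c := by
    rintro c hc rfl
    exact hgC (hperm.mem_iff.1 hc)
  have hle : ∀ c ∈ c0 :: c1 :: R, (g ∩ c).card ≤ 1 := fun c hc =>
    hlin g hgE c (hCE' c hc) (hgC' c hc)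
  have hone : ∀ c ∈ c0 :: c1 :: R, ∀ y ∈ g, y ∈ c → (g ∩ c).card = 1 := by
    intro c hc y hy hyc
    have := hle c hc
    have : 0 < (g ∩ c).card := Finset.card_pos.2 ⟨y, Finset.mem_inter.2 ⟨hy, hyc⟩⟩
    omega
  have hgK' : g ⊆ vset (c0 :: c1 :: R) := by rw [vset_perm hperm]; exact hgK
  have hlen := hperm.length_eq
  -- the remaining vertices of `g` avoid `c0`
  have hrest : ∀ y ∈ g, y ≠ p → y ∈ vset (c1 :: R) := by
    intro y hy hyp
    have h1 := hgK' hy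
    rw [vset_cons, Finset.mem_union] at h1
    refine h1.resolve_left (fun h => hyp ?_)
    exact Finset.card_le_one.1 (hle c0 (by simp)) y (by simp [hy, h]) p (by simp [hp, hp0])
  have hfirst : ∀ l : List (Finset V), (∃ y ∈ g, y ≠ p ∧ y ∈ vset l) →
      ∃ s a t, l = s ++ a :: t ∧ (∃ q ∈ g, q ≠ p ∧ q ∈ a) ∧ ∀ y ∈ g, y ≠ p → y ∉ vset s := by
    intro l
    induction l with
    | nil => rintro ⟨y, -, -, hy⟩; simp [vset_nil] at hy
    | cons b l ih =>
      rintro ⟨y, hyg, hyp, hy⟩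
      by_cases hb : ∃ q ∈ g, q ≠ p ∧ q ∈ b
      · exact ⟨[], b, l, rfl, hb, by simp [vset_nil]⟩
      · push Not at hb
        rw [vset_cons, Finset.mem_union] at hy
        obtain ⟨s, a, t, rfl, ha, hs⟩ := ih ⟨y, hyg, hyp, hy.resolve_left (hb y hyg hyp)⟩
        refine ⟨b :: s, a, t, rfl, ha, ?_⟩
        intro y hyg hyp
        rw [vset_cons, Finset.mem_union, not_or]
        exact ⟨hb y hyg hyp, hs y hyg hyp⟩
  have herase : 1 < (g.erase p).card := by rw [Finset.card_erase_of_mem hp]; omega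
  obtain ⟨y1, hy1, y2, hy2, hy12⟩ := Finset.one_lt_card.1 herase
  rw [Finset.mem_erase] at hy1 hy2
  obtain ⟨s, a, t, hsplit, ⟨q, hqg, hqp, hqa⟩, hs⟩ :=
    hfirst (c1 :: R) ⟨y1, hy1.2, hy1.1, hrest y1 hy1.2 hy1.1⟩
  have hmem : ∀ c ∈ s ++ a :: t, c ∈ c0 :: c1 :: R := by
    intro c hc; rw [← hsplit] at hc; exact List.mem_cons_of_mem _ hc
  have haC : a ∈ c0 :: c1 :: R := hmem a (by simp)
  have hlen2 : (c1 :: R).length = s.length + 1 + t.length := by rw [hsplit]; simp; omega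
  by_cases ht : 2 ≤ t.length
  · have hlp : LP (c0 :: (s ++ [a])) := by
      apply LooseCycle.lp_prefix (t := t)
      · rw [hsplit] at hCy
        simpa using hCy
      · rintro rfl; simp at ht
    have hcE : ∀ c ∈ c0 :: (s ++ [a]), c ∈ E := by
      intro c hc
      apply hCE'
      rw [hsplit]
      simp at hc ⊢
      tauto
    have hcyc : LooseCycle (g :: c0 :: (s ++ [a])) := by
      refine looseCycle_of_path hk hlp (fun c hc => hu c (hcE c hc)) hgk
        (hone c0 (by simp) p hp hp0) (hone a haC q hqg hqa) ?_
      rw [Finset.eq_empty_iff_forall_notMem]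
      intro y hy
      rw [Finset.mem_inter] at hy
      by_cases hyp : y = p
      · subst hyp
        cases s with
        | nil => simp [vset_nil] at hy
        | cons d s =>
          have hd : c1 = d := by
            have := congrArg List.head? hsplit
            simpa using this
          have h2 := hlp.2.1
          change c0 ∩ vset (s ++ [a]) = ∅ at h2
          have := not_mem_of_inter_empty h2 hp0
          rw [vset_append, Finset.mem_union, not_or] at this
          have h3 := hy.2
          rw [vset_cons, Finset.mem_union, ← hd] at h3
          tauto
      · exact hs y hy.1 hyp hy.2
    have := hmin _ hcyc (by
      intro c hc
      rw [List.mem_cons] at hc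
      rcases hc with rfl | hc
      · exact hgE
      · exact hcE c hc)
    simp at this hlen hlen2
    omega
  · -- now `g` has a further vertex in the last edge
    have hy : ∃ y ∈ g, y ≠ p ∧ y ≠ q := by
      by_cases h : y1 = q
      · exact ⟨y2, hy2.2, hy2.1, by rintro rfl; exact hy12 h⟩
      · exact ⟨y1, hy1.2, hy1.1, h⟩
    obtain ⟨r, hrg, hrp, hrq⟩ := hy
    have hrt : r ∈ vset t := by
      have h1 := hrest r hrg hrp
      rw [hsplit, vset_append, vset_cons, Finset.mem_union, Finset.mem_union] at h1
      rcases h1 with h1 | h1 | h1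
      · exact absurd h1 (hs r hrg hrp)
      · exact absurd (Finset.card_le_one.1 (hle a haC) r (by simp [hrg, h1]) q (by simp [hqg, hqa])) hrq
      · exact h1
    match t, ht, hrt with
    | [], _, hrt => simp [vset_nil] at hrt
    | _ :: _ :: _, ht, _ => simp at ht
    | [b], _, hrt =>
      rw [vset_singleton] at hrt
      have hbC : b ∈ c0 :: c1 :: R := hmem b (by simp)
      rw [hsplit] at hCy
      have hab : (a ∩ b).card = 1 := by
        have h5 := hCy.2.2 (s.length + 1) (s.length + 2) (by omega) (by simp)
        rw [if_pos (Or.inl rfl)] at h5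
        rw [List.getD_cons_succ, List.getD_cons_succ, List.getD_append_right _ _ _ _ le_rfl,
          List.getD_append_right _ _ _ _ (by omega)] at h5
        simpa using h5
      have hnab : a ≠ b := by
        rintro rfl
        rw [Finset.inter_self, hu a (hCE' a haC)] at hab
        omega
      have htri := triangle (hgC' a haC) hnab (hgC' b hbC) (hone a haC q hqg hqa) hab
        (hone b hbC r hrg hrt)
      have := hmin _ htri (by simp [hgE, hCE' a haC, hCE' b hbC])
      simp at this
      omega

theorem exists_loose_cycle {k : ℕ} (hk : 3 ≤ k) {E : Finset (Finset V)} (hu : Uniform k E)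
    (hnob : ¬ ContainsBicycle k E)
    (hT : ∀ a b : V, a ≠ b → ∀ e0 ∈ E, a ∈ e0 → ∃ e ∈ E, ¬ (a ∈ e ↔ b ∈ e))
    (hlin : ∀ a ∈ E, ∀ b ∈ E, a ≠ b → (a ∩ b).card ≤ 1) (hne : E.Nonempty) :
    ∃ C, LooseCycle C ∧ (∀ c ∈ C, c ∈ E) := by
  obtain ⟨e1, he1⟩ := hne
  obtain ⟨x, hx⟩ := Finset.card_pos.1 (show 0 < e1.card by rw [hu e1 he1]; omega)
  have hK : ∀ e ∈ E, e ⊆ {x} ∨ (e ∩ {x}).card ≤ 1 := fun e _ =>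
    Or.inr ((Finset.card_le_card Finset.inter_subset_right).trans (by simp))
  have h1 : (e1 ∩ {x}).card = 1 := by
    rw [Finset.inter_singleton_of_mem hx]; simp
  rcases path_lemma hk hu hT hK he1 h1 with ⟨l, P, -, -, hP, hPE, -⟩ | hb |
    ⟨l, e, f, z, hl, -, -, -, -, hfK, hz⟩ | ⟨f, z, hfE, hfe, hf2, -, -⟩
  · rcases hP with ⟨e, f, rfl, hne, h2, -⟩ | hP
    · have := hlin e (hPE e (by simp)) f (hPE f (by simp)) hne
      omega
    · exact ⟨P, hP, hPE⟩
  · exact absurd hb hnob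
  · exfalso
    have hzx : z = x := by simpa using (mem_of_inter_eq hfK).2
    obtain ⟨m, hm, -⟩ := hl.last (by simp)
    apply hz
    rw [hm, hzx]
    exact subset_vset (by simp) hx
  · have := hlin f hfE e1 he1 hfe
    omega

theorem cycle_pairing {k : ℕ} (hk : 3 ≤ k) {X : Finset V} {E : Finset (Finset V)}
    (hEX : ∀ e ∈ E, e ⊆ X) (hu : Uniform k E) {C : List (Finset V)} (hC : LooseCycle C)
    (hCE : ∀ c ∈ C, c ∈ E) (hall : ∀ e ∈ E, e ∈ C) :
    BreakerWins (fun M => ∃ e ∈ E, e ⊆ M) X := by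
  obtain ⟨hlen, hn, hC⟩ := hC
  let D : ℕ → Finset V := fun i =>
    C.getD i ∅ \ C.getD (if i = 0 then C.length - 1 else i - 1) ∅
  have hD : ∀ i, D i = C.getD i ∅ \ C.getD (if i = 0 then C.length - 1 else i - 1) ∅ := fun _ => rfl
  have hdis : ∀ i j, i < j → j < C.length → Disjoint (D i) (D j) := by
    intro i j hij hj
    rw [Finset.disjoint_left, hD, hD]
    intro y hy hy2
    rw [Finset.mem_sdiff] at hy hy2
    by_cases h1 : j = i + 1
    · subst h1
      apply hy2.2
      simpa using hy.1
    · by_cases h2 : i = 0 ∧ j = C.length - 1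
      · obtain ⟨rfl, rfl⟩ := h2
        apply hy.2
        simpa using hy2.1
      · have h3 := hC i j hij hj
        rw [if_neg (by tauto), Finset.card_eq_zero] at h3
        exact not_mem_of_inter_empty h3 hy.1 hy2.1
  refine breaker_pairing (D := (Finset.range C.length).image D) ?_ ?_ ?_ ?_
  · intro d hd
    obtain ⟨i, hi, rfl⟩ := Finset.mem_image.1 hd
    rw [Finset.mem_range] at hi
    exact Finset.sdiff_subset.trans (hEX _ (hCE _ (getD_mem hi)))
  · intro d hd
    obtain ⟨i, hi, rfl⟩ := Finset.mem_image.1 hd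
    rw [Finset.mem_range] at hi
    have h1 := hu _ (hCE _ (getD_mem hi))
    rw [hD]
    have h2 := Finset.card_sdiff_add_card_inter (C.getD i ∅)
      (C.getD (if i = 0 then C.length - 1 else i - 1) ∅)
    have h3 : (C.getD i ∅ ∩ C.getD (if i = 0 then C.length - 1 else i - 1) ∅).card = 1 := by
      by_cases hi0 : i = 0
      · subst hi0
        rw [if_pos rfl, hC 0 (C.length - 1) (by omega) (by omega), if_pos (Or.inr ⟨rfl, rfl⟩)]
      · rw [if_neg hi0, Finset.inter_comm, hC (i - 1) i (by omega) hi, if_pos (Or.inl (by omega))]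
    omega
  · intro d hd d' hd' hne
    obtain ⟨i, hi, rfl⟩ := Finset.mem_image.1 hd
    obtain ⟨j, hj, rfl⟩ := Finset.mem_image.1 hd'
    rw [Finset.mem_range] at hi hj
    rcases lt_trichotomy i j with h | h | h
    · exact hdis i j h hj
    · subst h; exact absurd rfl hne
    · exact (hdis j i h hi).symm
  · intro e he
    obtain ⟨i, hi, rfl⟩ := exists_getD (hall e he)
    exact ⟨D i, Finset.mem_image.2 ⟨i, Finset.mem_range.2 hi, rfl⟩, Finset.sdiff_subset⟩


theorem inter_eq_of_le_one {A B : Finset V} {y : V} (h : (A ∩ B).card ≤ 1) (hA : y ∈ A)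
    (hB : y ∈ B) : A ∩ B = {y} := by
  rw [Finset.card_le_one] at h
  have hy : y ∈ A ∩ B := Finset.mem_inter.2 ⟨hA, hB⟩
  ext w
  rw [Finset.mem_singleton]
  exact ⟨fun hw => h w hw y hy, fun hw => hw ▸ hy⟩

theorem eq_triple {A : Finset V} {x y z : V} (hA : A.card = 3) (hx : x ∈ A) (hy : y ∈ A)
    (hz : z ∈ A) (hxy : x ≠ y) (hxz : x ≠ z) (hyz : y ≠ z) : A = {x, y, z} := by
  symm
  apply Finset.eq_of_subset_of_card_le
  · intro w hw
    simp only [Finset.mem_insert, Finset.mem_singleton] at hw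
    rcases hw with rfl | rfl | rfl <;> assumption
  · rw [hA, Finset.card_eq_three.2 ⟨x, y, z, hxy, hxz, hyz, rfl⟩]

theorem pasch_stage {k : ℕ} (hk : 3 ≤ k) {X : Finset V} {E : Finset (Finset V)}
    (hEX : ∀ e ∈ E, e ⊆ X) (hu : Uniform k E) (hnob : ¬ ContainsBicycle k E)
    (hlin : ∀ a ∈ E, ∀ b ∈ E, a ≠ b → (a ∩ b).card ≤ 1) {a b c g : Finset V}
    (hC : LooseCycle [a, b, c]) (ha : a ∈ E) (hb : b ∈ E) (hc : c ∈ E) (hg : g ∈ E)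
    (hga : g ≠ a) (hgb : g ≠ b) (hgc : g ≠ c) (hgK : g ⊆ a ∪ (b ∪ c))
    (hall : ∀ e ∈ E, e ⊆ a ∪ (b ∪ c)) :
    BreakerWins (fun M => ∃ e ∈ E, e ⊆ M) X := by
  have hab : a ≠ b := by have := hC.2.1; simp at this; tauto
  have hac : a ≠ c := by have := hC.2.1; simp at this; tauto
  have hbc : b ≠ c := by have := hC.2.1; simp at this; tauto
  have iab : (a ∩ b).card = 1 := by have := hC.2.2 0 1 (by omega) (by simp); simpa using this
  have ibc : (b ∩ c).card = 1 := by have := hC.2.2 1 2 (by omega) (by simp); simpa using this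
  have iac : (a ∩ c).card = 1 := by have := hC.2.2 0 2 (by omega) (by simp); simpa using this
  have lga := hlin g hg a ha hga
  have lgb := hlin g hg b hb hgb
  have lgc := hlin g hg c hc hgc
  have hgk := hu g hg
  have hgeq : g = (g ∩ a) ∪ ((g ∩ b) ∪ (g ∩ c)) := by
    rw [← Finset.inter_union_distrib_left, ← Finset.inter_union_distrib_left,
      Finset.inter_eq_left.2 hgK]
  have u1 := Finset.card_union_le (g ∩ a) ((g ∩ b) ∪ (g ∩ c))
  have u2 := Finset.card_union_le (g ∩ b) (g ∩ c)
  rw [← hgeq] at u1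
  have iga : (g ∩ a).card = 1 := by omega
  have igb : (g ∩ b).card = 1 := by omega
  have igc : (g ∩ c).card = 1 := by omega
  have hk3 : k = 3 := by omega
  subst hk3
  obtain ⟨p, hp, hpg, hpa⟩ := card_one_mem iga
  obtain ⟨q, hq, hqg, hqb⟩ := card_one_mem igb
  obtain ⟨r, hr, hrg, hrc⟩ := card_one_mem igc
  have hg3 : g = {p, q, r} := by
    rw [hp, hq, hr] at hgeq
    exact hgeq
  have hpqr : p ≠ q ∧ p ≠ r ∧ q ≠ r := by
    rw [hp, hq, hr] at hgeq
    rw [hgeq] at hgk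
    refine ⟨?_, ?_, ?_⟩
    · rintro rfl
      have : ({p} ∪ ({p} ∪ {r}) : Finset V) = {p, r} := by ext; simp
      rw [this] at hgk
      have := Finset.card_le_two (a := p) (b := r); omega
    · rintro rfl
      have : ({p} ∪ ({q} ∪ {p}) : Finset V) = {p, q} := by ext; simp; tauto
      rw [this] at hgk
      have := Finset.card_le_two (a := p) (b := q); omega
    · rintro rfl
      have : ({p} ∪ ({q} ∪ {q}) : Finset V) = {p, q} := by ext; simp
      rw [this] at hgk
      have := Finset.card_le_two (a := p) (b := q); omega
  obtain ⟨hpq, hpr, hqr⟩ := hpqr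
  have hpb : p ∉ b := fun h => hpq (eq_of_inter_eq hq hpg h)
  have hpc : p ∉ c := fun h => hpr (eq_of_inter_eq hr hpg h)
  have hqa : q ∉ a := fun h => hpq (eq_of_inter_eq hp hqg h).symm
  have hqc : q ∉ c := fun h => hqr (eq_of_inter_eq hr hqg h)
  have hra : r ∉ a := fun h => hpr (eq_of_inter_eq hp hrg h).symm
  have hrb : r ∉ b := fun h => hqr (eq_of_inter_eq hq hrg h).symm
  obtain ⟨z1, hz1, hz1a, hz1b⟩ := card_one_mem iab
  obtain ⟨z2, hz2, hz2b, hz2c⟩ := card_one_mem ibc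
  obtain ⟨z3, hz3, hz3a, hz3c⟩ := card_one_mem iac
  have hz1c : z1 ∉ c := by
    intro hz1c
    apply hnob
    have htri : LooseCycle [a, b, g] :=
      triangle hab hgb.symm hga.symm iab (by rwa [Finset.inter_comm]) (by rwa [Finset.inter_comm])
    have hvs : vset [a, b, g] = a ∪ (b ∪ g) := by simp [vset]
    refine bicycle_handle hk hu (Or.inr htri) (by simp [ha, hb, hg]) hc ?_ ?_
    · rw [hvs]
      change 1 < _
      rw [Finset.one_lt_card]
      exact ⟨z1, by simp [hz1c, hz1a], r, by simp [hrc, hrg], by rintro rfl; exact hra hz1a⟩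
    · rw [hvs]
      intro hsub
      have : c ⊆ {z1, r} := by
        intro y hy
        have := hsub hy
        simp only [Finset.mem_union] at this
        rcases this with h | h | h
        · have e1 := eq_of_inter_eq hz3 h hy
          have e2 := eq_of_inter_eq hz3 hz1a hz1c
          simp [e1, e2]
        · have e1 := eq_of_inter_eq hz2 h hy
          have e2 := eq_of_inter_eq hz2 hz1b hz1c
          simp [e1, e2]
        · simp [eq_of_inter_eq hr h hy]
      have h6 := Finset.card_le_card this
      have h7 := Finset.card_le_two (a := z1) (b := r)
      rw [hu c hc] at h6
      omega
  have n12 : z1 ≠ z2 := by rintro rfl; exact hz1c hz2c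
  have n13 : z1 ≠ z3 := by rintro rfl; exact hz1c hz3c
  have n23 : z2 ≠ z3 := by rintro rfl; exact n12 (eq_of_inter_eq hz1 hz3a hz2b).symm
  have p1 : p ≠ z1 := by rintro rfl; exact hpb hz1b
  have p2 : p ≠ z2 := by rintro rfl; exact hpb hz2b
  have p3 : p ≠ z3 := by rintro rfl; exact hpc hz3c
  have q1 : q ≠ z1 := by rintro rfl; exact hqa hz1a
  have q2 : q ≠ z2 := by rintro rfl; exact hqc hz2c
  have q3 : q ≠ z3 := by rintro rfl; exact hqa hz3a
  have r1 : r ≠ z1 := by rintro rfl; exact hra hz1a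
  have r2 : r ≠ z2 := by rintro rfl; exact hrb hz2b
  have r3 : r ≠ z3 := by rintro rfl; exact hra hz3a
  have ea := eq_triple (hu a ha) hpa hz1a hz3a p1 p3 n13
  have eb := eq_triple (hu b hb) hqb hz1b hz2b q1 q2 n12
  have ec := eq_triple (hu c hc) hrc hz2c hz3c r2 r3 n23
  refine breaker_pasch (p := p) (q := q) (r := r) (z1 := z1) (z2 := z2) (z3 := z3) ?_ ?_ ?_
  · intro y hy
    simp only [Finset.mem_insert, Finset.mem_singleton] at hy
    rcases hy with rfl | rfl | rfl | rfl | rfl | rfl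
    · exact hEX a ha hpa
    · exact hEX b hb hqb
    · exact hEX c hc hrc
    · exact hEX a ha hz1a
    · exact hEX b hb hz2b
    · exact hEX a ha hz3a
  · simp [hpq, hpr, hqr, n12, n13, n23, p1, p2, p3, q1, q2, q3, r1, r2, r3]
  · intro h hh
    rw [← ea, ← eb, ← ec, ← hg3]
    by_contra hcon
    simp only [not_or] at hcon
    obtain ⟨hha, hhb, hhc, hhg⟩ := hcon
    have la := hlin h hh a ha hha
    have lb := Finset.card_le_one.1 (hlin h hh b hb hhb)
    have lc := Finset.card_le_one.1 (hlin h hh c hc hhc)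
    have lg := Finset.card_le_one.1 (hlin h hh g hg hhg)
    have hsd := Finset.card_sdiff_add_card_inter h a
    have hhk := hu h hh
    have h2 : 1 < (h \ a).card := by omega
    obtain ⟨u, hu1, w, hw1, huw⟩ := Finset.one_lt_card.1 h2
    rw [Finset.mem_sdiff] at hu1 hw1
    have key : ∀ y ∈ h, y ∉ a → y = q ∨ y = r ∨ y = z2 := by
      intro y hy hya
      have := hall h hh hy
      rw [Finset.mem_union, Finset.mem_union] at this
      rcases this with h3 | h3 | h3
      · exact absurd h3 hya
      · rw [eb] at h3
        simp only [Finset.mem_insert, Finset.mem_singleton] at h3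
        rcases h3 with h3 | h3 | h3
        · exact Or.inl h3
        · exact absurd (h3 ▸ hz1a) hya
        · exact Or.inr (Or.inr h3)
      · rw [ec] at h3
        simp only [Finset.mem_insert, Finset.mem_singleton] at h3
        rcases h3 with h3 | h3 | h3
        · exact Or.inr (Or.inl h3)
        · exact Or.inr (Or.inr h3)
        · exact absurd (h3 ▸ hz3a) hya
    have lb' : ∀ y ∈ h, y ∈ b → ∀ y' ∈ h, y' ∈ b → y = y' := fun y h1 h2 y' h3 h4 =>
      lb y (Finset.mem_inter.2 ⟨h1, h2⟩) y' (Finset.mem_inter.2 ⟨h3, h4⟩)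
    have lc' : ∀ y ∈ h, y ∈ c → ∀ y' ∈ h, y' ∈ c → y = y' := fun y h1 h2 y' h3 h4 =>
      lc y (Finset.mem_inter.2 ⟨h1, h2⟩) y' (Finset.mem_inter.2 ⟨h3, h4⟩)
    have lg' : ∀ y ∈ h, y ∈ g → ∀ y' ∈ h, y' ∈ g → y = y' := fun y h1 h2 y' h3 h4 =>
      lg y (Finset.mem_inter.2 ⟨h1, h2⟩) y' (Finset.mem_inter.2 ⟨h3, h4⟩)
    apply huw
    rcases key u hu1.1 hu1.2 with rfl | rfl | rfl <;> rcases key w hw1.1 hw1.2 with rfl | rfl | rfl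
    · rfl
    · exact lg' _ hu1.1 hqg _ hw1.1 hrg
    · exact lb' _ hu1.1 hqb _ hw1.1 hz2b
    · exact lg' _ hu1.1 hrg _ hw1.1 hqg
    · rfl
    · exact lc' _ hu1.1 hrc _ hw1.1 hz2c
    · exact lb' _ hu1.1 hz2b _ hw1.1 hqb
    · exact lc' _ hu1.1 hz2c _ hw1.1 hrc
    · rfl

theorem lc_stage {k : ℕ} (hk : 3 ≤ k) {X : Finset V} {E : Finset (Finset V)}
    (hEX : ∀ e ∈ E, e ⊆ X) (hu : Uniform k E) (hnob : ¬ ContainsBicycle k E)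
    (hT : ∀ a b : V, a ≠ b → ∀ e0 ∈ E, a ∈ e0 → ∃ e ∈ E, ¬ (a ∈ e ↔ b ∈ e))
    (hconn : ∀ W : Finset V, (∃ e ∈ E, e ⊆ W) → (∀ e ∈ E, e ⊆ W ∨ e ∩ W = ∅) → ∀ e ∈ E, e ⊆ W)
    (hlin : ∀ a ∈ E, ∀ b ∈ E, a ≠ b → (a ∩ b).card ≤ 1) (hne : E.Nonempty) :
    BreakerWins (fun M => ∃ e ∈ E, e ⊆ M) X := by
  classical
  have hex : ∃ n, ∃ C, (LooseCycle C ∧ ∀ c ∈ C, c ∈ E) ∧ C.length = n := by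
    obtain ⟨C, hC⟩ := exists_loose_cycle hk hu hnob hT hlin hne
    exact ⟨_, C, hC, rfl⟩
  obtain ⟨C, ⟨hC, hCE⟩, hlen⟩ := Nat.find_spec hex
  have hmin : ∀ C', LooseCycle C' → (∀ c ∈ C', c ∈ E) → C.length ≤ C'.length := by
    intro C' h1 h2
    rw [hlen]
    exact Nat.find_min' hex ⟨C', ⟨h1, h2⟩, rfl⟩
  clear hlen
  have hK := near_of_no_bicycle hk hu hnob (Or.inr hC) hCE
  have hc0 : ∃ e ∈ E, e ⊆ vset C := by
    have h0 : 0 < C.length := by have := hC.1; omega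
    exact ⟨_, hCE _ (getD_mem h0), subset_vset (getD_mem h0)⟩
  have hall : ∀ e ∈ E, e ⊆ vset C := by
    by_contra hcon
    obtain ⟨e1, he1, x, hx⟩ := exists_exit hconn hK hc0 hcon
    exact hnob (bicycle_B hk hu hT (Or.inr hC) hCE he1 hx hK (Or.inr ⟨hC, hlin⟩))
  by_cases hg : ∀ e ∈ E, e ∈ C
  · exact cycle_pairing hk hEX hu hC hCE hg
  · push Not at hg
    obtain ⟨g, hgE, hgC⟩ := hg
    by_cases h4 : 4 ≤ C.length
    · exact absurd (no_chord hk hu hlin hC hCE hmin h4 hgE hgC (hall g hgE)) id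
    · have h3 : C.length = 3 := by have := hC.1; omega
      obtain ⟨a, b, c, rfl⟩ := List.length_eq_three.1 h3
      simp only [List.mem_cons, List.not_mem_nil, or_false, not_or] at hgC
      have hvs : vset [a, b, c] = a ∪ (b ∪ c) := by simp [vset]
      rw [hvs] at hall
      exact pasch_stage hk hEX hu hnob hlin hC (hCE a (by simp)) (hCE b (by simp)) (hCE c (by simp))
        hgE hgC.1 hgC.2.1 hgC.2.2 (hall g hgE) hall

theorem main_ind {k : ℕ} (hk : 3 ≤ k) (n : ℕ) : ∀ (X : Finset V) (E : Finset (Finset V)),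
    E.card = n → (∀ e ∈ E, e ⊆ X) → Uniform k E → ¬ ContainsBicycle k E →
    BreakerWins (fun M => ∃ e ∈ E, e ⊆ M) X := by
  induction n using Nat.strong_induction_on with
  | _ n ih =>
  intro X E hn hEX hu hnob
  -- passing to a proper subset of the edges
  have hsub : ∀ (Y : Finset V) (F : Finset (Finset V)), F ⊂ E → (∀ e ∈ F, e ⊆ Y) →
      BreakerWins (fun M => ∃ e ∈ F, e ⊆ M) Y := by
    intro Y F hF hFY
    refine ih F.card (by rw [← hn]; exact Finset.card_lt_card hF) Y F rfl hFY
      (fun e he => hu e (hF.1 he)) ?_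
    rintro ⟨l, hl, hb⟩
    exact hnob ⟨l, hl.trans hF.1, hb⟩
  by_cases hne : E.Nonempty
  swap
  · rw [Finset.not_nonempty_iff_eq_empty] at hne
    subst hne
    exact breaker_pairing (D := ∅) (by simp) (by simp) (by simp) (by simp)
  by_cases hT : ∀ a b : V, a ≠ b → ∀ e0 ∈ E, a ∈ e0 → ∃ e ∈ E, ¬ (a ∈ e ↔ b ∈ e)
  swap
  · push Not at hT
    obtain ⟨a, b, hab, e0, he0, hae0, htw⟩ := hT
    have htw' : ∀ e ∈ E, (a ∈ e ↔ b ∈ e) := by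
      intro e he
      have := htw e he
      tauto
    have haX := hEX e0 he0 hae0
    have hbX := hEX e0 he0 ((htw' e0 he0).1 hae0)
    have hYX : ({a, b} : Finset V) ⊆ X := by
      intro y hy
      simp only [Finset.mem_insert, Finset.mem_singleton] at hy
      rcases hy with rfl | rfl <;> assumption
    have hF : ∀ e ∈ E.filter (fun e => a ∉ e), e ⊆ X \ {a, b} := by
      intro e he y hy
      rw [Finset.mem_filter] at he
      rw [Finset.mem_sdiff]
      refine ⟨hEX e he.1 hy, ?_⟩
      simp only [Finset.mem_insert, Finset.mem_singleton]
      rintro (rfl | rfl)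
      · exact he.2 hy
      · exact he.2 ((htw' e he.1).2 hy)
    refine breaker_split (D1 := {{a, b}}) (D2 := E.filter (fun e => a ∉ e)) hYX ?_ ?_ ?_
    · refine breaker_pairing (D := {{a, b}}) ?_ ?_ ?_ ?_
      · simp
      · intro d hd
        rw [Finset.mem_singleton] at hd
        rw [hd, Finset.card_pair hab]
      · intro d hd d' hd' h
        rw [Finset.mem_singleton] at hd hd'
        exact absurd (hd.trans hd'.symm) h
      · intro e he
        exact ⟨e, he, Finset.Subset.refl e⟩
    · refine hsub _ _ ?_ hF
      rw [Finset.filter_ssubset]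
      exact ⟨e0, he0, by simpa using hae0⟩
    · intro e he
      by_cases hae : a ∈ e
      · left
        refine ⟨{a, b}, by simp, ?_, Finset.Subset.refl _⟩
        intro y hy
        simp only [Finset.mem_insert, Finset.mem_singleton] at hy
        rcases hy with rfl | rfl
        · exact hae
        · exact (htw' e he).1 hae
      · right
        have hm : e ∈ E.filter (fun e => a ∉ e) := Finset.mem_filter.2 ⟨he, hae⟩
        exact ⟨e, hm, Finset.Subset.refl e, hF e hm⟩
  by_cases hconn : ∀ W : Finset V, (∃ e ∈ E, e ⊆ W) → (∀ e ∈ E, e ⊆ W ∨ e ∩ W = ∅) →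
      ∀ e ∈ E, e ⊆ W
  swap
  · push Not at hconn
    obtain ⟨W, ⟨e0, he0, he0W⟩, hW, e1, he1, he1W⟩ := hconn
    have hF1 : ∀ e ∈ E.filter (fun e => e ⊆ W), e ⊆ X ∩ W := by
      intro e he
      rw [Finset.mem_filter] at he
      exact Finset.subset_inter (hEX e he.1) he.2
    have hF2 : ∀ e ∈ E.filter (fun e => ¬ e ⊆ W), e ⊆ X \ (X ∩ W) := by
      intro e he y hy
      rw [Finset.mem_filter] at he
      have := not_mem_of_inter_empty ((hW e he.1).resolve_left he.2) hy
      rw [Finset.mem_sdiff, Finset.mem_inter]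
      exact ⟨hEX e he.1 hy, fun h => this h.2⟩
    refine breaker_split (D1 := E.filter (fun e => e ⊆ W)) (D2 := E.filter (fun e => ¬ e ⊆ W))
      (Y := X ∩ W) Finset.inter_subset_left ?_ ?_ ?_
    · refine hsub _ _ ?_ hF1
      rw [Finset.filter_ssubset]
      exact ⟨e1, he1, he1W⟩
    · refine hsub _ _ ?_ hF2
      rw [Finset.filter_ssubset]
      exact ⟨e0, he0, by simpa using he0W⟩
    · intro e he
      by_cases heW : e ⊆ W
      · left
        have hm : e ∈ E.filter (fun e => e ⊆ W) := Finset.mem_filter.2 ⟨he, heW⟩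
        exact ⟨e, hm, Finset.Subset.refl e, hF1 e hm⟩
      · right
        have hm : e ∈ E.filter (fun e => ¬ e ⊆ W) := Finset.mem_filter.2 ⟨he, heW⟩
        exact ⟨e, hm, Finset.Subset.refl e, hF2 e hm⟩
  by_cases hlin : ∀ a ∈ E, ∀ b ∈ E, a ≠ b → (a ∩ b).card ≤ 1
  · exact lc_stage hk hEX hu hnob hT hconn hlin hne
  · push Not at hlin
    obtain ⟨a, ha, b, hb, hab, h2⟩ := hlin
    exact op_stage hk hEX hu hnob hT hconn ha hb hab h2


/-- Lemma 3.4 of the paper / consequence of Lemmas 3.3 and 3.4. If a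
finite `k`-uniform hypergraph (with vertex set `X` and edge set `E`) contains no bicycle,
then Breaker has a winning strategy in the Maker-Breaker game played on it. -/
theorem breaker_wins_of_no_bicycle {V : Type*} [DecidableEq V] {k : ℕ} (hk : 3 ≤ k)
    (X : Finset V) (E : Finset (Finset V)) (hEX : ∀ e ∈ E, e ⊆ X)
    (hunif : Uniform k E) (hnob : ¬ ContainsBicycle k E) :
    BreakerWins (fun M => ∃ e ∈ E, e ⊆ M) X := by
  exact main_ind hk E.card X E rfl hEX hunif hnob
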